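/- arXiv:1207.4624 — 6 statements merged into one kernel-verified Lean document; each statement's English description precedes it below -/
import Mathlib

section
/- Any generalized Dirichlet series L(s) = \sum_{n\ge 0} a_n e^{-\lambda_n s} with 0 = \lambda_0 < \lambda_1 < \lambda_2 < \cdots that is absolutely convergent on the vertical line Re(s) = \sigma and vanishes on a subset of that line of positive (one-dimensional Lebesgue) measure must vanish identically. -/
open MeasureTheory Filter Complex

lemma jensen_ineq {G : ℂ → ℂ} {r : ℝ} (hr : 0 < r)
    (hG : AnalyticOnNhd ℂ G (Metric.closedBall 0 r)) (h0 : G 0 ≠ 0) {ε : ℝ} (hε : 0 < ε) :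
    Real.log ‖G 0‖ ≤ Real.circleAverage (fun z => Real.log (‖G z‖ + ε)) 0 r := by
  have hr' : |r| = r := abs_of_pos hr
  have h1 : Real.log ‖G 0‖ ≤ Real.circleAverage (fun z => Real.log ‖G z‖) 0 r := by
    have hG' : AnalyticOnNhd ℂ G (Metric.closedBall 0 |r|) := by rwa [hr']
    rw [hG'.circleAverage_log_norm hr.ne' h0]
    have : 0 ≤ ∑ᶠ u, (MeromorphicOn.divisor G (Metric.closedBall 0 |r|) u : ℝ) *
        Real.log (r * ‖0 - u‖⁻¹) := by
      apply finsum_nonneg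
      intro u
      by_cases hu : u ∈ Metric.closedBall (0:ℂ) |r|
      · apply mul_nonneg
        · exact_mod_cast (MeromorphicOn.AnalyticOnNhd.divisor_nonneg hG') u
        · by_cases hu0 : u = 0
          · simp [hu0]
          · apply Real.log_nonneg
            have : 0 < ‖u‖ := norm_pos_iff.2 hu0
            simp only [zero_sub, norm_neg]
            rw [← div_eq_mul_inv, le_div_iff₀ this]
            simpa [hr'] using hu
      · simp [Function.locallyFinsuppWithin.apply_eq_zero_of_notMem _ hu]
    linarith
  refine h1.trans ?_
  have hne : (fun z => Real.log ‖G z‖) =ᶠ[codiscreteWithin (Metric.sphere (0:ℂ) |r|)]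
      (fun z => if G z = 0 then Real.log ε else Real.log ‖G z‖) := by
    have := hG.preimage_zero_mem_codiscreteWithin (x := 0) h0 (by simp [hr.le])
      ((convex_closedBall (0:ℂ) r).isConnected ⟨0, by simp [hr.le]⟩)
    rw [hr']
    have h2 := Filter.codiscreteWithin_mono (Metric.sphere_subset_closedBall (x := (0:ℂ)) (ε := r)) this
    filter_upwards [h2] with z hz
    have : G z ≠ 0 := by simpa using hz
    simp [this]
  have hint : CircleIntegrable (fun z => Real.log ‖G z‖) 0 r := by
    apply MeromorphicOn.circleIntegrable_log_norm
    rw [hr']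
    exact (hG.mono Metric.sphere_subset_closedBall).meromorphicOn
  rw [Real.circleAverage_congr_codiscreteWithin hne hr.ne']
  apply Real.circleAverage_mono
  · exact hint.congr_codiscreteWithin hne
  · apply ContinuousOn.circleIntegrable hr.le
    have hc : ContinuousOn G (Metric.sphere 0 r) :=
      (hG.mono Metric.sphere_subset_closedBall).continuousOn
    apply ContinuousOn.log (by fun_prop)
    intro z hz; positivity
  · intro z hz
    split_ifs with h
    · simp [h]
    · have : 0 < ‖G z‖ := norm_pos_iff.2 h
      exact Real.log_le_log this (by linarith)

lemma disc_uniq {G : ℂ → ℂ} (hd : DifferentiableOn ℂ G (Metric.ball 0 1))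
    (hc : ContinuousOn G (Metric.closedBall 0 1 \ {1})) {C : ℝ}
    (hC : ∀ z ∈ Metric.closedBall (0:ℂ) 1 \ {1}, ‖G z‖ ≤ C) (h0 : G 0 ≠ 0)
    {S : Set ℝ} (hS : MeasurableSet S) (hS2 : S ⊆ Set.Ioc 0 (2 * Real.pi))
    (hSG : ∀ θ ∈ S, G (circleMap 0 1 θ) = 0) : volume S = 0 := by
  have hpi := Real.two_pi_pos
  have hC0 : 0 ≤ C := (norm_nonneg _).trans (hC 0 (by simp))
  have hSfin : volume S ≠ ⊤ := ((measure_mono hS2).trans_lt measure_Ioc_lt_top).ne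
  have hae : ∀ᵐ θ : ℝ, circleMap 0 1 θ ≠ 1 :=
    measure_eq_zero_iff_ae_notMem.mp
      (((Set.countable_singleton (1:ℂ)).preimage_circleMap 0 one_ne_zero).measure_zero volume)
  have hmem : ∀ r ∈ Set.Ioo (0:ℝ) 1, ∀ θ, circleMap 0 r θ ∈ Metric.closedBall (0:ℂ) 1 \ {1} := by
    intro r hr θ
    have hn : ‖circleMap 0 r θ‖ = r := by simp [abs_of_pos hr.1]
    refine ⟨by simpa [abs_of_pos hr.1] using hr.2.le, ?_⟩
    rintro h
    rw [Set.mem_singleton_iff] at h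
    rw [h] at hn; simp at hn; linarith [hr.2]
  have hbd : ∀ ε ∈ Set.Ioo (0:ℝ) 1, ∀ z ∈ Metric.closedBall (0:ℂ) 1 \ {1},
      ‖Real.log (‖G z‖ + ε)‖ ≤ |Real.log ε| + |Real.log (C + 1)| := by
    intro ε hε z hz
    have a1 : Real.log ε ≤ Real.log (‖G z‖ + ε) :=
      Real.log_le_log hε.1 (by linarith [norm_nonneg (G z)])
    have a2 : Real.log (‖G z‖ + ε) ≤ Real.log (C + 1) :=
      Real.log_le_log (by linarith [norm_nonneg (G z), hε.1]) (by linarith [hC z hz, hε.2])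
    rw [Real.norm_eq_abs, abs_le]
    constructor
    · linarith [neg_abs_le (Real.log ε), abs_nonneg (Real.log (C+1))]
    · linarith [le_abs_self (Real.log (C+1)), abs_nonneg (Real.log ε)]
  have hlim : ∀ θ : ℝ, circleMap 0 1 θ ≠ 1 →
      Tendsto (fun r : ℝ => G (circleMap 0 r θ)) (nhdsWithin 1 (Set.Iio 1))
        (nhds (G (circleMap 0 1 θ))) := by
    intro θ hθ
    have := hc (circleMap 0 1 θ) ⟨by simp, hθ⟩
    refine Tendsto.comp this (tendsto_nhdsWithin_iff.2 ⟨?_, ?_⟩)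
    · have : Continuous (fun r : ℝ => circleMap 0 r θ) := by unfold circleMap; fun_prop
      exact (this.tendsto 1).mono_left nhdsWithin_le_nhds
    · filter_upwards [Ioo_mem_nhdsLT (zero_lt_one' ℝ)] with r hr using hmem r hr θ
  have key : ∀ ε ∈ Set.Ioo (0:ℝ) 1, 2 * Real.pi * Real.log ‖G 0‖ ≤
      2 * Real.pi * Real.log (C + 1) + (volume S).toReal * Real.log ε := by
    intro ε hε
    have hcirc : ∀ r ∈ Set.Ioo (0:ℝ) 1,
        Continuous (fun θ => Real.log (‖G (circleMap 0 r θ)‖ + ε)) := by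
      intro r hr
      have : Continuous (fun θ => G (circleMap 0 r θ)) :=
        hc.comp_continuous (continuous_circleMap 0 r) (hmem r hr)
      apply Continuous.log (this.norm.add continuous_const)
      intro θ
      have h1 := hε.1
      have h2 := norm_nonneg (G (circleMap 0 r θ))
      exact (add_pos_of_nonneg_of_pos h2 h1).ne'
    have ht : Tendsto (fun r : ℝ => ∫ θ in (0:ℝ)..2 * Real.pi, Real.log (‖G (circleMap 0 r θ)‖ + ε))
        (nhdsWithin 1 (Set.Iio 1))
        (nhds (∫ θ in (0:ℝ)..2 * Real.pi, Real.log (‖G (circleMap 0 1 θ)‖ + ε))) := by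
      apply intervalIntegral.tendsto_integral_filter_of_dominated_convergence
        (fun _ => |Real.log ε| + |Real.log (C + 1)|)
      · filter_upwards [Ioo_mem_nhdsLT (zero_lt_one' ℝ)] with r hr
        exact (hcirc r hr).aestronglyMeasurable
      · filter_upwards [Ioo_mem_nhdsLT (zero_lt_one' ℝ)] with r hr
        exact Eventually.of_forall fun θ _ => hbd ε hε _ (hmem r hr θ)
      · simp
      · filter_upwards [hae] with θ hθ _
        have hpos : ‖G (circleMap 0 1 θ)‖ + ε ≠ 0 := by have := hε.1; positivity
        exact (((hlim θ hθ).norm.add_const ε).log hpos)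
    have hge : 2 * Real.pi * Real.log ‖G 0‖ ≤
        ∫ θ in (0:ℝ)..2 * Real.pi, Real.log (‖G (circleMap 0 1 θ)‖ + ε) := by
      apply ge_of_tendsto ht
      filter_upwards [Ioo_mem_nhdsLT (zero_lt_one' ℝ)] with r hr
      have := jensen_ineq hr.1 ((hd.analyticOnNhd Metric.isOpen_ball).mono
        (Metric.closedBall_subset_ball hr.2)) h0 hε.1
      rw [Real.circleAverage_def, smul_eq_mul, ← div_eq_inv_mul, le_div_iff₀ hpi] at this
      linarith
    refine hge.trans ?_
    have hK : 0 ≤ Real.log (C + 1) := Real.log_nonneg (by linarith)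
    have hmeas : AEStronglyMeasurable (fun θ => Real.log (‖G (circleMap 0 1 θ)‖ + ε)) volume := by
      refine aestronglyMeasurable_of_tendsto_ae (u := nhdsWithin (1:ℝ) (Set.Iio 1))
        (f := fun r θ => Real.log (‖G (circleMap 0 (if r ∈ Set.Ioo (0:ℝ) 1 then r else 1/2) θ)‖ + ε)) ?_ ?_
      · intro r
        apply Continuous.aestronglyMeasurable
        apply hcirc
        split_ifs with h
        · exact h
        · norm_num
      · filter_upwards [hae] with θ hθ
        have hpos : ‖G (circleMap 0 1 θ)‖ + ε ≠ 0 := by have := hε.1; positivity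
        refine (((hlim θ hθ).norm.add_const ε).log hpos).congr' ?_
        filter_upwards [Ioo_mem_nhdsLT (zero_lt_one' ℝ)] with r hr
        rw [if_pos hr]
    have hmem1 : ∀ θ, circleMap 0 1 θ ≠ 1 → circleMap 0 1 θ ∈ Metric.closedBall (0:ℂ) 1 \ {1} :=
      fun θ h => ⟨by simp, h⟩
    rw [intervalIntegral.integral_of_le hpi.le]
    have hi2 : Integrable (S.indicator fun _ : ℝ => Real.log ε)
        (volume.restrict (Set.Ioc 0 (2 * Real.pi))) :=
      (integrable_const _).indicator hS
    calc ∫ θ in Set.Ioc 0 (2 * Real.pi), Real.log (‖G (circleMap 0 1 θ)‖ + ε)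
        ≤ ∫ θ in Set.Ioc 0 (2 * Real.pi),
            (Real.log (C + 1) + S.indicator (fun _ : ℝ => Real.log ε) θ) := by
          apply integral_mono_ae
          · refine Integrable.mono' (integrable_const (|Real.log ε| + |Real.log (C + 1)|))
              hmeas.restrict ?_
            filter_upwards [ae_restrict_of_ae hae] with θ hθ using hbd ε hε _ (hmem1 θ hθ)
          · exact (integrable_const _).add hi2
          · filter_upwards [ae_restrict_of_ae hae] with θ hθ
            by_cases h : θ ∈ S
            · simp [h, hSG θ h, hK]
            · simp only [h, not_false_eq_true, Set.indicator_of_notMem, add_zero]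
              exact Real.log_le_log (by linarith [norm_nonneg (G (circleMap 0 1 θ)), hε.1])
                (by linarith [hC _ (hmem1 θ hθ), hε.2])
      _ = _ := by
          rw [integral_add (integrable_const _) hi2, integral_indicator_const _ hS]
          simp [measureReal_def, Measure.restrict_apply hS, Set.inter_eq_left.2 hS2, Real.pi_pos.le]
  by_contra hne
  have hm : 0 < (volume S).toReal := ENNReal.toReal_pos hne hSfin
  set m := (volume S).toReal
  set A := 2 * Real.pi * Real.log (C + 1) - 2 * Real.pi * Real.log ‖G 0‖ with hA
  have := key (Real.exp (-((|A| + 1) / m))) ⟨Real.exp_pos _, by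
    rw [Real.exp_lt_one_iff]; have : 0 < (|A| + 1) / m := by positivity
    linarith⟩
  rw [Real.log_exp] at this
  have h3 : m * -((|A| + 1) / m) = -(|A| + 1) := by field_simp
  rw [h3] at this
  linarith [le_abs_self A]

lemma half_plane_uniq (c : ℕ → ℂ) (mu : ℕ → ℝ) (hmu : ∀ n, 0 ≤ mu n)
    (hs : Summable fun n => ‖c n‖) (x : ℝ) (hx : 0 < x)
    (hne : ∑' n, c n * Complex.exp (-(mu n : ℂ) * x) ≠ 0)
    (E : Set ℝ) (hE : MeasurableSet E)
    (hv : ∀ t ∈ E, ∑' n, c n * Complex.exp (-(mu n : ℂ) * (t * Complex.I)) = 0) :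
    volume E = 0 := by
  set H : ℂ → ℂ := fun z => ∑' n, c n * Complex.exp (-(mu n : ℂ) * z) with hH
  have hb : ∀ n, ∀ z : ℂ, 0 ≤ z.re → ‖c n * Complex.exp (-(mu n : ℂ) * z)‖ ≤ ‖c n‖ := by
    intro n z hz
    rw [norm_mul, Complex.norm_exp]
    apply mul_le_of_le_one_right (norm_nonneg _)
    rw [Real.exp_le_one_iff]
    simp only [neg_mul, Complex.neg_re, Complex.re_ofReal_mul]
    have := mul_nonneg (hmu n) hz
    linarith
  have hHb : ∀ z : ℂ, 0 ≤ z.re → ‖H z‖ ≤ ∑' n, ‖c n‖ := fun z hz =>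
    tsum_of_norm_bounded hs.hasSum (fun n => hb n z hz)
  have hHc : ContinuousOn H {z | 0 ≤ z.re} :=
    continuousOn_tsum (fun n => by fun_prop) hs (fun n z hz => hb n z hz)
  have hHd : DifferentiableOn ℂ H {z | 0 < z.re} :=
    differentiableOn_tsum_of_summable_norm hs (fun n => by fun_prop)
      (isOpen_lt continuous_const Complex.continuous_re) (fun n z hz => hb n z (le_of_lt hz))
  -- the Cayley transform
  set T : ℂ → ℂ := fun w => x * ((1 + w) / (1 - w)) with hT
  have hTre : ∀ w : ℂ, (T w).re = x * ((1 - Complex.normSq w) / Complex.normSq (1 - w)) := by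
    intro w
    simp only [hT, Complex.re_ofReal_mul, Complex.div_re]
    rw [← add_div]
    congr 2
    simp [Complex.normSq_apply]
    ring
  have hT0 : ∀ w ∈ Metric.closedBall (0:ℂ) 1 \ {1}, 0 ≤ (T w).re := by
    intro w hw
    rw [hTre]
    have : ‖w‖ ≤ 1 := by simpa using hw.1
    have h2 : Complex.normSq w ≤ 1 := by
      rw [Complex.normSq_eq_norm_sq]; exact pow_le_one₀ (norm_nonneg _) this
    exact mul_nonneg hx.le (div_nonneg (by linarith) (Complex.normSq_nonneg _))
  have hT1 : ∀ w ∈ Metric.ball (0:ℂ) 1, 0 < (T w).re := by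
    intro w hw
    rw [hTre]
    have : ‖w‖ < 1 := by simpa using hw
    have h2 : Complex.normSq w < 1 := by
      rw [Complex.normSq_eq_norm_sq]; exact pow_lt_one₀ (norm_nonneg _) this two_ne_zero
    refine mul_pos hx (div_pos (by linarith) (Complex.normSq_pos.2 ?_))
    rw [sub_ne_zero]; rintro rfl; simp at this
  have hTc : ContinuousOn T (Metric.closedBall (0:ℂ) 1 \ {1}) := by
    apply ContinuousOn.mul continuousOn_const
    apply ContinuousOn.div (by fun_prop) (by fun_prop)
    intro w hw
    rw [sub_ne_zero]; exact fun h => hw.2 h.symm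
  have hTd : DifferentiableOn ℂ T (Metric.ball (0:ℂ) 1) := by
    apply DifferentiableOn.const_mul
    apply DifferentiableOn.div (by fun_prop) (by fun_prop)
    intro w hw
    rw [sub_ne_zero]; rintro rfl; simp at hw
  set φ : ℝ → ℝ := fun θ => x * (Real.sin θ / (1 - Real.cos θ)) with hφ
  have hcos : ∀ θ ∈ Set.Ioo 0 (2 * Real.pi), 1 - Real.cos θ ≠ 0 := by
    intro θ hθ h
    have := (Real.cos_eq_one_iff_of_lt_of_lt (by linarith [hθ.1, Real.pi_pos]) hθ.2).1
      (by linarith)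
    exact hθ.1.ne' this
  have hTφ : ∀ θ ∈ Set.Ioo 0 (2 * Real.pi), T (circleMap 0 1 θ) = φ θ * Complex.I := by
    intro θ hθ
    have h1 := hcos θ hθ
    have e : circleMap 0 1 θ = (Real.cos θ : ℂ) + (Real.sin θ : ℂ) * Complex.I := by
      simp [circleMap, Complex.exp_mul_I]
    have hsc : (Real.sin θ : ℂ) ^ 2 + (Real.cos θ : ℂ) ^ 2 = 1 := by
      exact_mod_cast Real.sin_sq_add_cos_sq θ
    have h1' : (1 - (Real.cos θ : ℂ)) ≠ 0 := by exact_mod_cast h1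
    have h2 : (1 - ((Real.cos θ : ℂ) + (Real.sin θ : ℂ) * Complex.I)) ≠ 0 := by
      intro h
      apply h1
      have := congrArg Complex.re h
      simpa [-Complex.ofReal_cos, -Complex.ofReal_sin] using this
    simp only [hT, hφ, e, Complex.ofReal_mul, Complex.ofReal_div, Complex.ofReal_sub,
      Complex.ofReal_one]
    generalize (Real.cos θ : ℂ) = u at *
    generalize (Real.sin θ : ℂ) = v at *
    rw [mul_assoc]
    congr 1
    rw [div_mul_eq_mul_div, div_eq_div_iff h2 h1']
    linear_combination -hsc + v ^ 2 * Complex.I_sq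
  set S : Set ℝ := Set.Ioo 0 (2 * Real.pi) ∩ φ ⁻¹' E with hSdef
  have hφm : Measurable φ := by
    apply Measurable.const_mul
    exact Real.measurable_sin.div (measurable_const.sub Real.measurable_cos)
  have hS0 : volume S = 0 := by
    apply disc_uniq (G := fun w => H (T w)) (C := ∑' n, ‖c n‖)
    · exact hHd.comp hTd hT1
    · exact hHc.comp hTc hT0
    · exact fun z hz => hHb _ (hT0 z hz)
    · have hTz : T 0 = x := by simp [hT]
      change H (T 0) ≠ 0
      rw [hTz]; exact hne
    · exact measurableSet_Ioo.inter (hφm hE)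
    · exact fun θ hθ => ⟨hθ.1.1, hθ.1.2.le⟩
    · intro θ hθ
      change H (T (circleMap 0 1 θ)) = 0
      rw [hTφ θ hθ.1]
      exact hv _ hθ.2
  have hφd : DifferentiableOn ℝ φ S := by
    apply DifferentiableOn.const_mul
    apply DifferentiableOn.div (by fun_prop) (by fun_prop)
    exact fun θ hθ => hcos θ hθ.1
  have him : E ⊆ φ '' S := by
    intro t ht
    have h1 := Real.neg_pi_div_two_lt_arctan (t / x)
    have h2 := Real.arctan_lt_pi_div_two (t / x)
    have hval : φ (Real.pi - 2 * Real.arctan (t / x)) = t := by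
      simp only [hφ, Real.sin_pi_sub, Real.cos_pi_sub, Real.sin_two_mul, Real.cos_two_mul]
      have hc : Real.cos (Real.arctan (t / x)) ≠ 0 := (Real.cos_arctan_pos _).ne'
      have ht' := Real.tan_arctan (t / x)
      rw [Real.tan_eq_sin_div_cos, div_eq_iff hc] at ht'
      rw [ht']
      generalize Real.cos (Real.arctan (t / x)) = y at *
      have : (1 - -(2 * y ^ 2 - 1)) = 2 * y ^ 2 := by ring
      rw [this]
      field_simp
    refine ⟨Real.pi - 2 * Real.arctan (t / x), ⟨⟨by linarith, by linarith⟩, ?_⟩, hval⟩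
    rw [Set.mem_preimage, hval]; exact ht
  exact measure_mono_null him
    (addHaar_image_eq_zero_of_differentiableOn_of_addHaar_eq_zero volume hφd hS0)

/-- A generalized Dirichlet series absolutely convergent on the line Re(s) = σ
that vanishes on a subset of that line of positive Lebesgue measure vanishes
identically (all coefficients are zero). -/
theorem dirichlet_series_vanishing_on_positive_measure
    (lam : ℕ → ℝ) (hlam0 : lam 0 = 0) (hmono : StrictMono lam)
    (htop : Tendsto lam atTop atTop)
    (a : ℕ → ℂ) (σ : ℝ)
    (habs : Summable (fun n => ‖a n‖ * Real.exp (-(lam n) * σ)))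
    (E : Set ℝ) (hE : MeasurableSet E) (hEpos : 0 < volume E)
    (hvanish : ∀ t ∈ E,
      ∑' n, a n * Complex.exp (-(lam n : ℂ) * (σ + t * Complex.I)) = 0) :
    ∀ n, a n = 0 := by
  classical
  by_contra hcon
  push Not at hcon
  set N := Nat.find hcon with hN
  have haN : a N ≠ 0 := Nat.find_spec hcon
  have hlt : ∀ n < N, a n = 0 := fun n hn => by simpa using Nat.find_min hcon hn
  set c : ℕ → ℂ := fun n => a (n + N) * Complex.exp (-(lam (n + N) : ℂ) * σ) with hc
  set mu : ℕ → ℝ := fun n => lam (n + N) - lam N with hmu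
  have hmu0 : ∀ n, 0 ≤ mu n := fun n => sub_nonneg.2 (hmono.monotone (Nat.le_add_left N n))
  have hs : Summable fun n => ‖c n‖ := by
    have := (summable_nat_add_iff N).2 habs
    refine this.congr fun n => ?_
    simp only [hc, norm_mul, Complex.norm_exp]
    congr 2
    simp
  have hlim : Tendsto (fun x : ℝ => ∑' n, c n * Complex.exp (-(mu n : ℂ) * x)) atTop
      (nhds (∑' n, if n = 0 then c 0 else 0)) := by
    apply tendsto_tsum_of_dominated_convergence hs
    · intro n
      by_cases hn : n = 0
      · subst hn
        simp [hmu]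
      · simp only [hn, if_false]
        have hpos : 0 < mu n := sub_pos.2 (hmono (by omega))
        rw [tendsto_zero_iff_norm_tendsto_zero]
        have h1 : Tendsto (fun x : ℝ => ‖c n‖ * Real.exp (-(mu n * x))) atTop (nhds (‖c n‖ * 0)) :=
          (Real.tendsto_exp_neg_atTop_nhds_zero.comp (tendsto_id.const_mul_atTop hpos)).const_mul _
        rw [mul_zero] at h1
        refine h1.congr fun x => ?_
        rw [norm_mul (c n), Complex.norm_exp]
        congr 2
        simp
    · filter_upwards [eventually_ge_atTop 0] with x hx n
      rw [norm_mul, Complex.norm_exp]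
      apply mul_le_of_le_one_right (norm_nonneg _)
      rw [Real.exp_le_one_iff]
      simp only [neg_mul, Complex.neg_re, Complex.re_ofReal_mul, Complex.ofReal_re]
      have := mul_nonneg (hmu0 n) hx
      linarith
  rw [tsum_ite_eq] at hlim
  have hc0 : c 0 ≠ 0 := by
    simp only [hc, zero_add]
    exact mul_ne_zero haN (Complex.exp_ne_zero _)
  obtain ⟨x, hxne, hx⟩ := ((hlim.eventually_ne hc0).and (eventually_gt_atTop 0)).exists
  refine hEpos.ne' (half_plane_uniq c mu hmu0 hs x hx hxne E hE ?_)
  intro t ht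
  have h := hvanish t ht
  have hinj : Function.Injective (fun n : ℕ => n + N) := add_left_injective N
  rw [← hinj.tsum_eq] at h
  · have h2 : ∀ n, a (n + N) * Complex.exp (-(lam (n + N) : ℂ) * (σ + t * Complex.I)) =
        Complex.exp (-(lam N : ℂ) * (t * Complex.I)) *
          (c n * Complex.exp (-(mu n : ℂ) * (t * Complex.I))) := by
      intro n
      simp only [hc, hmu]
      rw [mul_assoc, ← Complex.exp_add, mul_left_comm, ← Complex.exp_add]
      congr 2
      push_cast
      ring
    simp only [h2] at h
    rw [tsum_mul_left] at h
    exact (mul_eq_zero.1 h).resolve_left (Complex.exp_ne_zero _)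
  · intro n hn
    have : N ≤ n := by
      by_contra hlt'
      exact hn (by simp [hlt n (by omega)])
    exact ⟨n - N, by simp; omega⟩
end

section
/- Let 0 = \lambda_0 < \lambda_1 < \cdots satisfy the Dirichlet condition and let B_n be positive reals with \sum_{n\ge 1} B_n < \infty. Then for every H > 0 there exists \delta > 0 such that for all complex coefficients b_n with |b_n| \le B_n, one has \int_0^H |1 + \sum_{n\ge 1} b_n e^{-i\lambda_n t}| dt \ge \delta. -/
open MeasureTheory Filter Complex

lemma aux_center (F : ℂ → ℂ) (hd : DifferentiableOn ℂ F {z | 0 < z.re})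
    (hc : ContinuousOn F {z | 0 ≤ z.re}) (H : ℝ)
    (h0 : ∀ t ∈ Set.Icc (0:ℝ) H, F (t * I) = 0) (s : ℝ) (hs : 0 < s) (hsH : s ≤ H / 2) :
    F (s + (H / 2 : ℝ) * I) = 0 := by
  set c : ℂ := s + (H / 2 : ℝ) * I with hcdef
  have cre : c.re = s := by simp [hcdef]
  have cim : c.im = H / 2 := by simp [hcdef]
  set V : Set ℂ := Set.Ioo (-s) s ×ℂ Set.Ioo (-s) s with hV
  have hne : (-s) ≠ s := by linarith
  have hclV : closure V = Set.Icc (-s) s ×ℂ Set.Icc (-s) s := by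
    rw [hV, closure_reProdIm, closure_Ioo hne]
  have key : ∀ ζ : ℂ, (∀ w ∈ V, -s < (ζ * w).re) →
      (∀ w ∈ closure V, -s ≤ (ζ * w).re) → DiffContOnCl ℂ (fun w => F (c + ζ * w)) V := by
    intro ζ h1 h2
    refine ⟨?_, ?_⟩
    · refine hd.comp (by fun_prop) ?_
      intro w hw
      have := h1 w hw
      simp only [Set.mem_setOf_eq, add_re, cre]
      linarith
    · refine hc.comp (by fun_prop) ?_
      intro w hw
      have := h2 w hw
      simp only [Set.mem_setOf_eq, add_re, cre]
      linarith
  have k1 := key 1 (by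
    intro w hw; rw [hV, mem_reProdIm] at hw; simpa using hw.1.1) (by
    intro w hw; rw [hclV, mem_reProdIm] at hw; simpa using hw.1.1)
  have k2 := key (-1) (by
    intro w hw; rw [hV, mem_reProdIm] at hw; simpa using hw.1.2) (by
    intro w hw; rw [hclV, mem_reProdIm] at hw; simpa using hw.1.2)
  have k3 := key I (by
    intro w hw; rw [hV, mem_reProdIm] at hw; simpa using hw.2.2) (by
    intro w hw; rw [hclV, mem_reProdIm] at hw; simpa using hw.2.2)
  have k4 := key (-I) (by
    intro w hw; rw [hV, mem_reProdIm] at hw; simpa using hw.2.1) (by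
    intro w hw; rw [hclV, mem_reProdIm] at hw; simpa using hw.2.1)
  set G : ℂ → ℂ := fun w => F (c + 1 * w) * F (c + -1 * w) * (F (c + I * w) * F (c + -I * w))
    with hG
  have hGd : DiffContOnCl ℂ G V :=
    ⟨(k1.1.mul k2.1).mul (k3.1.mul k4.1), (k1.2.mul k2.2).mul (k3.2.mul k4.2)⟩
  have hzero : ∀ z : ℂ, z.re = -s → z.im ∈ Set.Icc (-s) s → F (c + z) = 0 := by
    intro z hz hz'
    have : c + z = ((H / 2 + z.im : ℝ) : ℂ) * I := by
      apply Complex.ext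
      · simp [cre, hz]
      · simp [cim]
    rw [this]
    apply h0
    constructor <;> linarith [hz'.1, hz'.2]
  have hbd : Bornology.IsBounded V :=
    (Metric.isBounded_Ioo _ _).reProdIm (Metric.isBounded_Ioo _ _)
  have hfr : ∀ z ∈ frontier V, ‖G z‖ ≤ 0 := by
    intro z hz
    have hzc : z ∈ closure V := frontier_subset_closure hz
    rw [hclV, mem_reProdIm] at hzc
    obtain ⟨hr, hi⟩ := hzc
    have hr' : -z.re ∈ Set.Icc (-s) s := ⟨by linarith [hr.2], by linarith [hr.1]⟩
    have hi' : -z.im ∈ Set.Icc (-s) s := ⟨by linarith [hi.2], by linarith [hi.1]⟩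
    rw [hV, frontier_reProdIm, frontier_Ioo (by linarith)] at hz
    rw [norm_le_zero_iff]
    rcases hz with hz | hz
    · rw [mem_reProdIm] at hz
      rcases hz.2 with h | h
      · have := hzero (-I * z) (by simp [h]) (by simpa using hr')
        simp only [hG, this, mul_zero]
      · have h : z.im = s := h
        have := hzero (I * z) (by simp [h]) (by simpa using hr)
        simp only [hG, this, mul_zero, zero_mul]
    · rw [mem_reProdIm] at hz
      rcases hz.1 with h | h
      · have := hzero (1 * z) (by simp [h]) (by simpa using hi)
        simp only [hG, this, zero_mul]
      · have h : z.re = s := h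
        have := hzero (-1 * z) (by simp [h]) (by simpa using hi')
        simp only [hG, this, mul_zero, zero_mul]
  have h0V : (0:ℂ) ∈ closure V := by
    rw [hclV, mem_reProdIm]; simp [hs.le]
  have := Complex.norm_le_of_forall_mem_frontier_norm_le hbd hGd hfr h0V
  rw [norm_le_zero_iff] at this
  simpa [hG] using this

lemma aux_unique (F : ℂ → ℂ) (hd : DifferentiableOn ℂ F {z | 0 < z.re})
    (hc : ContinuousOn F {z | 0 ≤ z.re}) (H : ℝ) (hH : 0 < H)
    (h0 : ∀ t ∈ Set.Icc (0:ℝ) H, F (t * I) = 0) (x : ℝ) (hx : 0 < x) : F x = 0 := by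
  have hop : IsOpen {z : ℂ | 0 < z.re} := isOpen_lt continuous_const continuous_re
  have han : AnalyticOnNhd ℂ F {z | 0 < z.re} := hd.analyticOnNhd hop
  have hpre : IsPreconnected {z : ℂ | 0 < z.re} := (convex_halfSpace_re_gt 0).isPreconnected
  set z₀ : ℂ := (H / 4 : ℝ) + (H / 2 : ℝ) * I with hz₀
  have hz₀m : z₀ ∈ {z : ℂ | 0 < z.re} := by simp [hz₀, hH]
  have hfreq : ∃ᶠ z in nhdsWithin z₀ {z₀}ᶜ, F z = 0 := by
    have ht : Tendsto (fun s : ℝ => (s : ℂ) + (H / 2 : ℝ) * I)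
        (nhdsWithin (H / 4) (Set.Iio (H / 4))) (nhdsWithin z₀ {z₀}ᶜ) := by
      apply tendsto_nhdsWithin_of_tendsto_nhds_of_eventually_within
      · apply Tendsto.mono_left _ nhdsWithin_le_nhds
        have : Continuous (fun s : ℝ => (s : ℂ) + (H / 2 : ℝ) * I) := by fun_prop
        exact this.tendsto (H / 4)
      · filter_upwards [self_mem_nhdsWithin] with s hs
        intro h
        have h := congrArg Complex.re (Set.mem_singleton_iff.1 h)
        have hs : s < H / 4 := hs
        simp [hz₀] at h
        linarith
    apply ht.frequently
    apply Eventually.frequently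
    filter_upwards [Ioo_mem_nhdsLT (show 0 < H / 4 by linarith)] with s hs
    exact aux_center F hd hc H h0 s hs.1 (by linarith [hs.2])
  exact han.eqOn_zero_of_preconnected_of_frequently_eq_zero hpre hz₀m hfreq
    (show 0 < (x : ℂ).re by simpa using hx)

lemma aux_norm (l : ℝ) (hl : 0 < l) (z : ℂ) (hz : 0 ≤ z.re) (b : ℂ) (B : ℝ) (hb : ‖b‖ ≤ B) :
    ‖b * Complex.exp (-(l * z))‖ ≤ B := by
  rw [norm_mul, Complex.norm_exp]
  have h1 : Real.exp (-(l * z)).re ≤ 1 := by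
    rw [Real.exp_le_one_iff]
    have := mul_nonneg hl.le hz
    simpa using this
  calc _ ≤ ‖b‖ * 1 := by gcongr
    _ ≤ B := by simpa using hb

lemma aux_nonzero
    (lam : ℕ → ℝ) (hpos : ∀ n, 0 < lam n)
    (B : ℕ → ℝ) (hBsum : Summable B) (H : ℝ) (hH : 0 < H) (b : ℕ → ℂ) (hb : ∀ n, ‖b n‖ ≤ B n) :
    ∃ t ∈ Set.Icc (0:ℝ) H, 1 + ∑' n, b n * Complex.exp (-Complex.I * (lam n) * t) ≠ 0 := by
  by_contra hcon
  push Not at hcon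
  set F : ℂ → ℂ := fun z => 1 + ∑' n, b n * Complex.exp (-(lam n * z)) with hF
  have hop : IsOpen {z : ℂ | 0 < z.re} := isOpen_lt continuous_const continuous_re
  have hd : DifferentiableOn ℂ F {z | 0 < z.re} := by
    apply DifferentiableOn.const_add
    refine differentiableOn_tsum_of_summable_norm hBsum (fun n => by fun_prop) hop ?_
    intro n z hz
    exact aux_norm _ (hpos n) z (le_of_lt hz) _ _ (hb n)
  have hc : ContinuousOn F {z | 0 ≤ z.re} := by
    apply ContinuousOn.add continuousOn_const
    refine continuousOn_tsum (fun n => by fun_prop) hBsum ?_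
    intro n z hz
    exact aux_norm _ (hpos n) z hz _ _ (hb n)
  have hz : ∀ x : ℝ, 0 < x → F x = 0 := by
    apply aux_unique F hd hc H hH
    intro t ht
    rw [← hcon t ht]
    simp only [hF]
    congr 2
    ext n
    congr 2
    ring
  have hlim : Tendsto (fun x : ℝ => F x) atTop (nhds (1 + ∑' n : ℕ, (0:ℂ))) := by
    apply Tendsto.const_add
    refine tendsto_tsum_of_dominated_convergence hBsum ?_ ?_
    · intro n
      rw [tendsto_zero_iff_norm_tendsto_zero]
      have : ∀ x : ℝ, ‖b n * Complex.exp (-(lam n * x))‖ = ‖b n‖ * Real.exp (-(lam n * x)) := by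
        intro x
        rw [norm_mul, Complex.norm_exp]
        simp
      simp only [this]
      rw [show (0:ℝ) = ‖b n‖ * 0 by simp]
      apply Tendsto.const_mul
      apply Real.tendsto_exp_neg_atTop_nhds_zero.comp
      exact tendsto_id.const_mul_atTop (hpos n)
    · filter_upwards [eventually_ge_atTop 0] with x hx n
      exact aux_norm _ (hpos n) x (by simpa using hx) _ _ (hb n)
  have hlim0 : Tendsto (fun x : ℝ => F x) atTop (nhds 0) := by
    apply tendsto_const_nhds.congr'
    filter_upwards [eventually_gt_atTop 0] with x hx
    exact (hz x hx).symm
  have := tendsto_nhds_unique hlim hlim0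
  simp at this

/-- Lemma 1: if the exponents satisfy the Dirichlet condition and the coefficient
bounds are summable, then the L¹(0,H) norm of 1 + ∑ bₙ e^{-iλₙt} is bounded below
by a positive constant depending only on H, (λₙ) and (Bₙ). -/
theorem dirichlet_series_L1_lower_bound
    (lam : ℕ → ℝ) (hmono : StrictMono lam) (hpos : ∀ n, 0 < lam n)
    (htop : Tendsto lam atTop atTop)
    (B : ℕ → ℝ) (hB : ∀ n, 0 < B n) (hBsum : Summable B) :
    ∀ H > (0:ℝ), ∃ δ > (0:ℝ), ∀ b : ℕ → ℂ, (∀ n, ‖b n‖ ≤ B n) →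
      δ ≤ ∫ t in (0:ℝ)..H,
        ‖1 + ∑' n, b n * Complex.exp (-Complex.I * (lam n) * t)‖ := by
  intro H hH
  set K : Set (ℕ → ℂ) := Set.pi Set.univ (fun n => Metric.closedBall (0:ℂ) (B n)) with hK
  have hKc : IsCompact K := isCompact_univ_pi (fun n => isCompact_closedBall _ _)
  have hKm : ∀ b : ℕ → ℂ, b ∈ K ↔ ∀ n, ‖b n‖ ≤ B n := by
    intro b; simp [hK, Set.mem_pi]
  haveI : CompactSpace K := isCompact_iff_compactSpace.1 hKc
  haveI : Nonempty K := ⟨⟨0, (hKm 0).2 (fun n => by simpa using (hB n).le)⟩⟩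
  have hcont : Continuous (Function.uncurry (fun (b : K) (t : ℝ) =>
      ‖1 + ∑' n, b.1 n * Complex.exp (-Complex.I * (lam n) * t)‖)) := by
    apply Continuous.norm
    apply Continuous.add continuous_const
    refine continuous_tsum (u := B) (fun n => ?_) hBsum ?_
    · have : Continuous (fun p : K × ℝ => p.1.1 n) :=
        (continuous_apply n).comp (continuous_subtype_val.comp continuous_fst)
      fun_prop
    · rintro n ⟨b, t⟩
      have := aux_norm (lam n) (hpos n) (t * I) (by simp) (b.1 n) (B n) ((hKm _).1 b.2 n)
      rw [show -((lam n : ℂ) * (t * I)) = -Complex.I * (lam n) * t by ring] at this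
      exact this
  have hint : Continuous (fun b : K => ∫ t in (0:ℝ)..H,
      ‖1 + ∑' n, b.1 n * Complex.exp (-Complex.I * (lam n) * t)‖) :=
    intervalIntegral.continuous_parametric_intervalIntegral_of_continuous' hcont 0 H
  obtain ⟨b₀, -, hb₀⟩ := isCompact_univ.exists_isMinOn Set.univ_nonempty hint.continuousOn
  refine ⟨_, ?_, fun b hb => hb₀ (Set.mem_univ (⟨b, (hKm b).2 hb⟩ : K))⟩
  obtain ⟨t, ht, hne⟩ := aux_nonzero lam hpos B hBsum H hH b₀.1 ((hKm _).1 b₀.2)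
  refine intervalIntegral.integral_pos hH ?_ (fun _ _ => norm_nonneg _) ⟨t, ht, norm_pos_iff.2 hne⟩
  exact (hcont.comp (Continuous.prodMk_right b₀)).continuousOn
end

section
/- (Paley–Wiener) Suppose S(x) is a positive increasing function on [0,\infty) with \int_0^\infty \log S(x)/(1+x^2) dx < \infty. Then for every \epsilon > 0 there exists an entire function \phi of exponential type at most \epsilon, not identically zero, such that |\phi(x)| \le 1/S(|x|) for all real x. -/
open MeasureTheory Filter Complex

noncomputable def pwG (w : ℂ) : ℂ := dslope Complex.exp 0 w

lemma pwG_zero : pwG 0 = 1 := by simp [pwG]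

lemma pwG_of_ne {w : ℂ} (hw : w ≠ 0) : pwG w = (Complex.exp w - 1) / w := by
  simp [pwG, dslope_of_ne _ hw, slope_def_field]

lemma pwG_diff : Differentiable ℂ pwG := by
  have := (Complex.differentiableOn_dslope (f := Complex.exp) (s := Set.univ) (c := 0)
    Filter.univ_mem).2 Complex.differentiable_exp.differentiableOn
  exact differentiableOn_univ.1 this

lemma pwG_norm_le (w : ℂ) : ‖pwG w‖ ≤ Real.exp ‖w‖ := by
  by_cases hw : w = 0
  · simp [hw, pwG_zero]
  · rw [pwG_of_ne hw, norm_div, div_le_iff₀ (norm_pos_iff.2 hw)]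
    have := Complex.norm_exp_sub_sum_le_norm_mul_exp w 1
    simp at this
    linarith

lemma pwG_sub_one_le (w : ℂ) : ‖pwG w - 1‖ ≤ ‖w‖ * Real.exp ‖w‖ := by
  by_cases hw : w = 0
  · simp [hw, pwG_zero]
  · have h : pwG w - 1 = (Complex.exp w - (1 + w)) / w := by
      rw [pwG_of_ne hw]; field_simp; ring
    rw [h, norm_div, div_le_iff₀ (norm_pos_iff.2 hw)]
    have := Complex.norm_exp_sub_sum_le_norm_mul_exp w 2
    simp [Finset.sum_range_succ] at this
    nlinarith

lemma pwG_im_le_one (y : ℝ) : ‖pwG (Complex.I * y)‖ ≤ 1 := by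
  by_cases hw : (Complex.I * y : ℂ) = 0
  · simp [hw, pwG_zero]
  · rw [pwG_of_ne hw, norm_div, div_le_iff₀ (norm_pos_iff.2 hw)]
    have := Real.norm_exp_I_mul_ofReal_sub_one_le (x := y)
    simpa using this

lemma pwG_im_le (y : ℝ) : ‖pwG (Complex.I * y)‖ * |y| ≤ 2 := by
  by_cases hw : (Complex.I * y : ℂ) = 0
  · have : y = 0 := by simpa using hw
    simp [this]
  · have hy : y ≠ 0 := by simpa using hw
    rw [pwG_of_ne hw, norm_div]
    have h1 : ‖Complex.I * (y:ℂ)‖ = |y| := by simp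
    rw [h1, div_mul_cancel₀ _ (abs_ne_zero.2 hy)]
    refine (norm_sub_le _ _).trans ?_
    rw [mul_comm, Complex.norm_exp_ofReal_mul_I]
    norm_num

lemma pow_sub_one_le (u : ℂ) (B : ℝ) (hB : 1 ≤ B) (hu : ‖u‖ ≤ B) (m : ℕ) :
    ‖u ^ m - 1‖ ≤ m * ‖u - 1‖ * B ^ m := by
  induction m with
  | zero => simp
  | succ m ih =>
    have h : u ^ (m+1) - 1 = u * (u ^ m - 1) + (u - 1) := by ring
    have h1 : 1 ≤ B ^ (m+1) := one_le_pow₀ hB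
    calc ‖u ^ (m+1) - 1‖ ≤ ‖u‖ * ‖u ^ m - 1‖ + ‖u - 1‖ := by
          rw [h]; refine (norm_add_le _ _).trans ?_; rw [norm_mul]
      _ ≤ B * (m * ‖u - 1‖ * B ^ m) + ‖u - 1‖ * B ^ (m+1) := by
          gcongr
          nlinarith [norm_nonneg (u - 1)]
      _ = _ := by push_cast; ring

lemma factor_bound (m : ℕ) (hm : 1 ≤ m) (w : ℂ) :
    ‖pwG w ^ m - 1‖ ≤ (m * ‖w‖) * Real.exp (2 * (m * ‖w‖)) := by
  have hm' : (1:ℝ) ≤ m := by exact_mod_cast hm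
  refine (pow_sub_one_le _ _ (Real.one_le_exp (norm_nonneg w)) (pwG_norm_le w) m).trans ?_
  rw [← Real.exp_nat_mul]
  calc (m:ℝ) * ‖pwG w - 1‖ * Real.exp (m * ‖w‖)
      ≤ m * (‖w‖ * Real.exp (m * ‖w‖)) * Real.exp (m * ‖w‖) := by
        gcongr
        refine (pwG_sub_one_le w).trans ?_
        gcongr
        nlinarith [norm_nonneg w]
    _ = _ := by rw [two_mul (_ * _), Real.exp_add]; ring

/-- The infinite product. -/
lemma exists_prod (a : ℕ → ℝ) (m : ℕ → ℕ) (ha : ∀ n, 0 ≤ a n) (hm : ∀ n, 1 ≤ m n)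
    (hs : Summable (fun n => m n * a n)) (ε : ℝ) (hε : ∑' n, m n * a n ≤ ε) :
    ∃ φ : ℂ → ℂ, Differentiable ℂ φ ∧ φ 0 = 1 ∧ (∀ z, ‖φ z‖ ≤ Real.exp (ε * ‖z‖)) ∧
      (∀ x : ℝ, ‖φ x‖ ≤ 1) ∧ ∀ (x : ℝ) n, 6 ≤ a n * |x| → ‖φ x‖ ≤ Real.exp (-(m n)) := by
  have hnn : ∀ n, 0 ≤ m n * a n := fun n => mul_nonneg (Nat.cast_nonneg _) (ha n)
  have hε0 : 0 ≤ ε := (tsum_nonneg hnn).trans hε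
  set F : ℕ → ℂ → ℂ := fun n z => pwG (Complex.I * (a n : ℂ) * z) ^ m n with hF
  have hFd : ∀ n, Differentiable ℂ (F n) := fun n =>
    (pwG_diff.comp (by fun_prop : Differentiable ℂ fun z : ℂ => Complex.I * (a n : ℂ) * z)).pow _
  have hnorm : ∀ n (z : ℂ), ‖Complex.I * (a n : ℂ) * z‖ = a n * ‖z‖ := fun n z => by
    simp [abs_of_nonneg (ha n)]
  have hloc : ∀ R > 0, HasProdLocallyUniformlyOn F (fun z => ∏' n, F n z) (Metric.ball 0 R) := by
    intro R hR
    have := Summable.hasProdLocallyUniformlyOn_nat_one_add (f := fun n z => F n z - 1)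
      (K := Metric.ball (0:ℂ) R) Metric.isOpen_ball
      (u := fun n => (m n * a n) * (R * Real.exp (2 * (ε * R)))) (hs.mul_right (R * Real.exp (2 * (ε * R)))) ?_
      (fun n => ((hFd n).sub_const 1).continuous.continuousOn)
    · simpa using this
    · refine Eventually.of_forall fun n z hz => ?_
      have hz' : ‖z‖ ≤ R := by simpa using (Metric.mem_ball.1 hz).le
      refine (factor_bound _ (hm n) _).trans ?_
      rw [hnorm]
      have h1 : m n * (a n * ‖z‖) ≤ (m n * a n) * R := by
        rw [← mul_assoc]; exact mul_le_mul_of_nonneg_left hz' (hnn n)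
      have h2 : m n * a n ≤ ε := (hs.le_tsum n fun j _ => hnn j).trans hε
      have h3 : (m n * a n) * R ≤ ε * R := by gcongr
      calc _ ≤ ((m n * a n) * R) * Real.exp (2 * (ε * R)) := by
            refine mul_le_mul h1 (Real.exp_le_exp.2 ?_) (Real.exp_pos _).le
              (mul_nonneg (hnn n) hR.le)
            linarith
        _ = _ := by ring
  have hprod : ∀ z, HasProd (fun n => F n z) (∏' n, F n z) := fun z =>
    (hloc (‖z‖ + 1) (by positivity)).hasProd (by simp)
  have hFnorm : ∀ n z, ‖F n z‖ ≤ Real.exp (m n * a n * ‖z‖) := by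
    intro n z
    rw [hF]; simp only [norm_pow]
    calc _ ≤ Real.exp (a n * ‖z‖) ^ m n := by
          gcongr; rw [← hnorm]; exact pwG_norm_le _
      _ = _ := by rw [← Real.exp_nat_mul, mul_assoc]
  have hcast : ∀ n (x : ℝ), (Complex.I * (a n : ℂ) * x) = Complex.I * ((a n * x : ℝ) : ℂ) := by
    intro n x; push_cast; ring
  have hF1 : ∀ n (x : ℝ), ‖F n x‖ ≤ 1 := by
    intro n x
    rw [hF]; simp only [norm_pow, hcast]
    exact pow_le_one₀ (norm_nonneg _) (pwG_im_le_one _)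
  refine ⟨fun z => ∏' n, F n z, ?_, ?_, ?_, ?_, ?_⟩
  · intro z
    have hd := (hloc (‖z‖ + 1) (by positivity)).differentiableOn
      (.of_forall fun s => (Differentiable.fun_finsetProd fun n _ => hFd n).differentiableOn)
        Metric.isOpen_ball
    exact hd.differentiableAt (Metric.isOpen_ball.mem_nhds (by simp))
  · simp [hF, pwG_zero]
  · intro z
    refine le_of_tendsto (hprod z).norm (.of_forall fun s => ?_)
    calc ∏ n ∈ s, ‖F n z‖ ≤ ∏ n ∈ s, Real.exp (m n * a n * ‖z‖) :=
          Finset.prod_le_prod (fun _ _ => norm_nonneg _) fun n _ => hFnorm n z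
      _ = Real.exp ((∑ n ∈ s, m n * a n) * ‖z‖) := by rw [← Real.exp_sum, Finset.sum_mul]
      _ ≤ _ := by
        gcongr
        exact (hs.sum_le_tsum s fun n _ => hnn n).trans hε
  · intro x
    refine le_of_tendsto (hprod x).norm (.of_forall fun s => ?_)
    exact Finset.prod_le_one (fun _ _ => norm_nonneg _) fun n _ => hF1 n x
  · intro x n hx
    refine le_of_tendsto (hprod x).norm ((eventually_ge_atTop {n}).mono fun s hs => ?_)
    have hn : n ∈ s := by simpa using hs
    rw [← Finset.mul_prod_erase s _ hn]
    have h1 : ‖pwG (Complex.I * ((a n * x : ℝ) : ℂ))‖ ≤ Real.exp (-1) := by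
      have h := pwG_im_le (a n * x)
      rw [abs_mul, abs_of_nonneg (ha n)] at h
      have h3 : ‖pwG (Complex.I * ((a n * x : ℝ) : ℂ))‖ ≤ 1 / 3 := by
        nlinarith [norm_nonneg (pwG (Complex.I * ((a n * x : ℝ) : ℂ)))]
      refine h3.trans ?_
      rw [Real.exp_neg, one_div]
      exact inv_anti₀ (Real.exp_pos _) (Real.exp_one_lt_three.le)
    have h2 : ‖F n x‖ ≤ Real.exp (-(m n)) := by
      rw [hF]; simp only [norm_pow, hcast]
      calc _ ≤ Real.exp (-1) ^ m n := by gcongr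
        _ = _ := by rw [← Real.exp_nat_mul]; simp
    calc _ ≤ ‖F n x‖ * 1 := by
          gcongr
          exact Finset.prod_le_one (fun _ _ => norm_nonneg _) fun n _ => hF1 n x
      _ ≤ _ := by simpa using h2

lemma summable_dyadic (H : ℝ → ℝ) (h0 : ∀ x, 0 ≤ H x) (hmono : MonotoneOn H (Set.Ici 0))
    (hint : IntegrableOn (fun x => H x / (1 + x ^ 2)) (Set.Ici 0)) :
    Summable (fun k : ℕ => H (2 ^ k) / 2 ^ k) := by
  have hd : Pairwise (Function.onFun Disjoint fun k : ℕ => Set.Ioc ((2:ℝ) ^ k) (2 ^ (k+1))) := by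
    have := (pow_right_mono₀ (one_le_two : (1:ℝ) ≤ 2)).pairwise_disjoint_on_Ioc_succ
    simpa using this
  have hsub : (⋃ k : ℕ, Set.Ioc ((2:ℝ) ^ k) (2 ^ (k+1))) ⊆ Set.Ici 0 := by
    intro x hx
    obtain ⟨k, hk⟩ := Set.mem_iUnion.1 hx
    exact (by positivity : (0:ℝ) ≤ 2 ^ k).trans hk.1.le
  have hs := (hasSum_integral_iUnion (fun k => measurableSet_Ioc) hd (hint.mono_set hsub)).summable
  refine Summable.of_nonneg_of_le (fun k => div_nonneg (h0 _) (by positivity)) (fun k => ?_)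
    (hs.mul_left 8)
  have hp : (0:ℝ) < 2 ^ k := by positivity
  have hle : ∫ x in Set.Ioc ((2:ℝ) ^ k) (2 ^ (k+1)), H (2 ^ k) / (8 * (2 ^ k) ^ 2) ≤
      ∫ x in Set.Ioc ((2:ℝ) ^ k) (2 ^ (k+1)), H x / (1 + x ^ 2) := by
    refine setIntegral_mono_on (by simp) (hint.mono_set ((Set.subset_iUnion _ k).trans hsub))
      measurableSet_Ioc fun x hx => ?_
    have hx0 : 0 ≤ x := hp.le.trans hx.1.le
    have h1 : (1:ℝ) ≤ 2 ^ k := one_le_pow₀ one_le_two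
    have hx2 : x ≤ 2 ^ k * 2 := by have := hx.2; rwa [pow_succ] at this
    gcongr
    · exact h0 _
    · exact hmono hp.le hx0 hx.1.le
    · nlinarith
  rw [setIntegral_const] at hle
  have : (volume.real (Set.Ioc ((2:ℝ) ^ k) (2 ^ (k+1)))) = 2 ^ k := by
    rw [Real.volume_real_Ioc_of_le (by rw [pow_succ]; linarith)]; ring
  rw [this, smul_eq_mul] at hle
  have e : H (2 ^ k) / 2 ^ k = 8 * (2 ^ k * (H (2 ^ k) / (8 * (2 ^ k) ^ 2))) := by
    field_simp
  rw [e]; linarith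

/-- Paley–Wiener: if S is positive increasing with ∫₀^∞ log S(x)/(1+x²) dx < ∞,
then for every ε > 0 there is a nonzero entire function of exponential type at
most ε with |φ(x)| ≤ 1/S(|x|) on the real line. -/
theorem paley_wiener_majorant
    (S : ℝ → ℝ) (hpos : ∀ x, 0 < S x) (hmono : MonotoneOn S (Set.Ici 0))
    (hint : IntegrableOn (fun x => Real.log (S x) / (1 + x ^ 2)) (Set.Ici 0)) :
    ∀ ε > (0:ℝ), ∃ φ : ℂ → ℂ, Differentiable ℂ φ ∧ φ ≠ 0 ∧
      (∀ η > (0:ℝ), ∃ C : ℝ, ∀ z : ℂ, ‖φ z‖ ≤ C * Real.exp ((ε + η) * ‖z‖)) ∧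
      ∀ x : ℝ, ‖φ (x : ℂ)‖ ≤ 1 / S |x| := by
  intro ε hε
  set H : ℝ → ℝ := fun x => max (Real.log (S x)) 0 with hH
  have hH0 : ∀ x, 0 ≤ H x := fun x => le_max_right _ _
  have hHm : MonotoneOn H (Set.Ici 0) := fun x hx y hy hxy =>
    max_le_max (Real.log_le_log (hpos x) (hmono hx hy hxy)) le_rfl
  have hSH : ∀ x, Real.exp (-H x) ≤ 1 / S x := fun x => by
    rw [Real.exp_neg, one_div]
    refine inv_anti₀ (hpos x) ?_
    calc S x = Real.exp (Real.log (S x)) := (Real.exp_log (hpos x)).symm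
      _ ≤ _ := Real.exp_le_exp.2 (le_max_left _ _)
  have hHi : IntegrableOn (fun x => H x / (1 + x ^ 2)) (Set.Ici 0) := by
    refine (Integrable.pos_part hint).congr (.of_forall fun x => ?_)
    have : (0:ℝ) < 1 + x ^ 2 := by positivity
    simp only [hH]
    rw [← max_div_div_right this.le, zero_div]
  have hsum := summable_dyadic H hH0 hHm hHi
  set b : ℕ → ℝ := fun k => (⌈H (2 ^ (k+1))⌉₊ + 1 : ℕ) * (6 / 2 ^ k) with hb
  have hb0 : ∀ k, 0 ≤ b k := fun k => by positivity
  have hbs : Summable b := by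
    have h1 := ((summable_nat_add_iff 1).2 hsum).mul_left 12
    have h2 := (summable_geometric_two).mul_left 12
    refine Summable.of_nonneg_of_le hb0 (fun k => ?_) (h1.add h2)
    have h3 := (Nat.ceil_lt_add_one (hH0 (2 ^ (k+1)))).le
    have e : 12 * (H (2 ^ (k+1)) / 2 ^ (k+1)) + 12 * (1 / 2 : ℝ) ^ k =
      (H (2 ^ (k+1)) + 1 + 1) * (6 / 2 ^ k) := by
      rw [pow_succ, div_pow, one_pow]; field_simp; ring
    rw [e, hb]
    push_cast
    gcongr
  obtain ⟨K, hK⟩ := ((tendsto_sum_nat_add b).eventually (gt_mem_nhds hε)).exists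
  obtain ⟨φ, hd, h0, htype, h1, hdec⟩ := exists_prod (fun n => 6 / 2 ^ (n + K))
    (fun n => ⌈H (2 ^ (n+K+1))⌉₊ + 1) (fun n => by positivity) (fun n => by omega)
    ((summable_nat_add_iff K).2 hbs) ε hK.le
  set c : ℝ := Real.exp (-H (2 ^ K)) with hc
  have hc0 : 0 < c := Real.exp_pos _
  have hc1 : c ≤ 1 := Real.exp_le_one_iff.2 (by linarith [hH0 (2 ^ K)])
  refine ⟨fun z => (c : ℂ) * φ z, hd.const_mul _, ?_, ?_, ?_⟩
  · intro h
    have := congrFun h 0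
    simp [h0, hc0.ne'] at this
  · intro η hη
    refine ⟨1, fun z => ?_⟩
    rw [norm_mul, Complex.norm_real, Real.norm_of_nonneg hc0.le]
    refine mul_le_mul hc1 ((htype z).trans ?_) (norm_nonneg _) zero_le_one
    gcongr
    linarith
  · intro x
    refine le_trans ?_ (hSH |x|)
    rw [norm_mul, Complex.norm_real, Real.norm_of_nonneg hc0.le]
    by_cases hx : |x| < 2 ^ K
    · calc c * ‖φ x‖ ≤ c * 1 := by gcongr; exact h1 x
        _ = c := mul_one c
        _ ≤ _ := Real.exp_le_exp.2 (neg_le_neg (hHm (abs_nonneg x)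
          (by positivity : (0:ℝ) ≤ 2 ^ K) hx.le))
    · push Not at hx
      obtain ⟨k, hk1, hk2⟩ := exists_nat_pow_near
        ((one_le_pow₀ (one_le_two : (1:ℝ) ≤ 2)).trans hx) (one_lt_two : (1:ℝ) < 2)
      have hKk : K ≤ k := by
        have := (pow_lt_pow_iff_right₀ (one_lt_two : (1:ℝ) < 2)).1 (hx.trans_lt hk2)
        omega
      obtain ⟨n, rfl⟩ : ∃ n, k = n + K := ⟨k - K, by omega⟩
      have h := hdec x n (by
        rw [div_mul_eq_mul_div, le_div_iff₀ (by positivity)]; linarith)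
      calc c * ‖φ x‖ ≤ 1 * ‖φ x‖ := by gcongr
        _ = ‖φ x‖ := one_mul _
        _ ≤ _ := h
        _ ≤ _ := by
          apply Real.exp_le_exp.2
          have h3 := hHm (abs_nonneg x) (by positivity : (0:ℝ) ≤ 2 ^ (n+K+1)) hk2.le
          have h4 := Nat.le_ceil (H (2 ^ (n+K+1)))
          push_cast
          linarith
end

section
/- (Paley–Wiener) If \phi is an entire function of exponential type A and \int_{-\infty}^{\infty} |\phi(x)|^2 dx < \infty, then the Fourier transform of the restriction of \phi to the real line is supported in [-A, A]. -/
open MeasureTheory Filter Complex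

/-- Exponential type. -/
def PWType (φ : ℂ → ℂ) (A : ℝ) : Prop :=
  ∀ η > (0:ℝ), ∃ C : ℝ, ∀ z : ℂ, ‖φ z‖ ≤ C * Real.exp ((A + η) * ‖z‖)

lemma PWType.nn {φ : ℂ → ℂ} {A : ℝ} (h : PWType φ A) :
    ∀ η > (0:ℝ), ∃ C : ℝ, 0 ≤ C ∧ ∀ z : ℂ, ‖φ z‖ ≤ C * Real.exp ((A + η) * ‖z‖) := by
  intro η hη
  obtain ⟨C, hC⟩ := h η hη
  exact ⟨C, by simpa using (norm_nonneg _).trans (hC 0), hC⟩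

/-- Cauchy–Schwarz for continuous functions on an interval. -/
lemma pw_cs {f g : ℝ → ℝ} (hf : Continuous f) (hg : Continuous g) {a b : ℝ} (hab : a ≤ b) :
    (∫ x in a..b, f x * g x) ^ 2 ≤ (∫ x in a..b, f x ^ 2) * (∫ x in a..b, g x ^ 2) := by
  have key : ∀ c : ℝ, 0 ≤ (∫ x in a..b, g x ^ 2) * (c * c)
      + (-2 * ∫ x in a..b, f x * g x) * c + (∫ x in a..b, f x ^ 2) := by
    intro c
    have h0 : 0 ≤ ∫ x in a..b, (f x - c * g x) ^ 2 :=
      intervalIntegral.integral_nonneg hab (fun x _ => sq_nonneg _)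
    have h1 : (fun x => (f x - c * g x) ^ 2)
        = fun x => (f x ^ 2 - (2 * c) * (f x * g x)) + (c * c) * (g x ^ 2) := by
      funext x; ring
    rw [h1, intervalIntegral.integral_add, intervalIntegral.integral_sub,
      intervalIntegral.integral_const_mul, intervalIntegral.integral_const_mul] at h0
    · linarith
    all_goals exact Continuous.intervalIntegrable (by fun_prop) _ _
  have := discrim_le_zero key
  unfold discrim at this
  nlinarith

lemma pw_cs_norm {f g : ℝ → ℂ} (hf : Continuous f) (hg : Continuous g) {a b : ℝ} (hab : a ≤ b) :
    ‖∫ x in a..b, f x * g x‖ ^ 2 ≤ (∫ x in a..b, ‖f x‖ ^ 2) * (∫ x in a..b, ‖g x‖ ^ 2) := by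
  refine le_trans ?_ (pw_cs hf.norm hg.norm hab)
  gcongr
  refine (intervalIntegral.norm_integral_le_integral_norm hab).trans (le_of_eq ?_)
  simp

/-- Phragmén–Lindelöf in the lower half plane. -/
lemma pw_PL {G : ℂ → ℂ} {A M : ℝ} (hA : 0 ≤ A) (hG : Differentiable ℂ G) (ht : PWType G A)
    (hM : ∀ x : ℝ, ‖G x‖ ≤ M) (z : ℂ) (hz : z.im ≤ 0) :
    ‖G z‖ ≤ M * Real.exp (A * (-z.im)) := by
  have key : ∀ η > (0:ℝ), ‖G z‖ ≤ M * Real.exp ((A + η) * (-z.im)) := by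
    intro η hη
    obtain ⟨C, hC0, hC⟩ := ht.nn η hη
    set f : ℂ → ℂ := fun w => G (-I * w) * cexp (-((A + η : ℝ) : ℂ) * w) with hf
    have hfd : Differentiable ℂ f := by
      rw [hf]
      exact (hG.comp (by fun_prop)).mul (by fun_prop)
    have hfn : ∀ w, ‖f w‖ = ‖G (-I * w)‖ * Real.exp (-(A + η) * w.re) := by
      intro w
      simp only [hf, norm_mul, Complex.norm_exp]
      congr 2
      simp
    have hfb : ∀ w, ‖f w‖ ≤ C * Real.exp ((A + η) * ‖w‖) * Real.exp (-(A + η) * w.re) := by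
      intro w
      rw [hfn]
      gcongr
      simpa using hC (-I * w)
    have h := PhragmenLindelof.right_half_plane_of_bounded_on_real (f := f) (C := M)
      (z := I * z) hfd.diffContOnCl ?_ ?_ ?_ (by simpa using hz)
    · rw [hfn] at h
      have e1 : -I * (I * z) = z := by rw [← mul_assoc]; simp
      rw [e1] at h
      have e2 : (I * z).re = -z.im := by simp
      rw [e2] at h
      calc ‖G z‖ = ‖G z‖ * Real.exp (-(A + η) * -z.im) * Real.exp ((A + η) * (-z.im)) := by
            rw [mul_assoc, ← Real.exp_add, show -(A + η) * -z.im + (A + η) * -z.im = 0 by ring]; simp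
        _ ≤ _ := by gcongr
    · refine ⟨1, by norm_num, A + η, ?_⟩
      refine Asymptotics.IsBigO.of_bound C ?_
      refine Filter.Eventually.filter_mono inf_le_right ?_
      refine Filter.eventually_principal.2 ?_
      intro w hw
      have hw' : 0 < w.re := hw
      refine (hfb w).trans ?_
      have : Real.exp (-(A + η) * w.re) ≤ 1 := by
        rw [Real.exp_le_one_iff]; nlinarith
      rw [Real.rpow_one, Real.norm_eq_abs, abs_of_pos (Real.exp_pos _)]
      exact mul_le_of_le_one_right (by positivity) this
    · refine ⟨C, ?_⟩
      rw [Filter.eventually_map]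
      filter_upwards [Filter.eventually_ge_atTop (0:ℝ)] with x hx
      refine (hfb x).trans (le_of_eq ?_)
      rw [mul_assoc, ← Real.exp_add, Complex.norm_real, Real.norm_eq_abs, abs_of_nonneg hx,
        Complex.ofReal_re, show (A + η) * x + -(A + η) * x = 0 by ring]
      simp
    · intro x
      rw [hfn]
      have e1 : -I * ((x:ℂ) * I) = x := by
        rw [mul_comm (x:ℂ), ← mul_assoc]; simp
      rw [e1]
      simpa using hM x
  have hlim : Tendsto (fun η : ℝ => M * Real.exp ((A + η) * (-z.im))) (nhdsWithin 0 (Set.Ioi 0))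
      (nhds (M * Real.exp (A * (-z.im)))) := by
    refine Tendsto.mono_left ?_ nhdsWithin_le_nhds
    exact Continuous.tendsto' (by fun_prop) _ _ (by simp)
  exact ge_of_tendsto hlim (by filter_upwards [self_mem_nhdsWithin] with η hη using key η hη)

lemma pw_conv_diff {φ : ℂ → ℂ} (hφ : Differentiable ℂ φ) {g : ℝ → ℂ} (hg : Continuous g)
    (a b : ℝ) : Differentiable ℂ (fun z => ∫ s in a..b, φ (z + s) * g s) := by
  intro z₀
  have hd : Continuous (deriv φ) := (hφ.contDiff (n := 1)).continuous_deriv le_rfl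
  have hφc := hφ.continuous
  obtain ⟨B, hB⟩ : ∃ B, ∀ p ∈ (Metric.closedBall z₀ 1) ×ˢ (Set.uIcc a b),
      ‖deriv φ (p.1 + (p.2:ℝ)) * g p.2‖ ≤ B := by
    refine IsCompact.exists_bound_of_continuousOn
      ((isCompact_closedBall _ _).prod isCompact_uIcc) ?_
    exact Continuous.continuousOn (by fun_prop)
  refine (intervalIntegral.hasDerivAt_integral_of_dominated_loc_of_deriv_le
    (F := fun z s => φ (z + (s:ℝ)) * g s) (F' := fun z s => deriv φ (z + (s:ℝ)) * g s)
    (bound := fun _ => B) (μ := volume) (x₀ := z₀) (a := a) (b := b)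
    (Metric.closedBall_mem_nhds z₀ one_pos) ?_ ?_ ?_ ?_ ?_ ?_).2.differentiableAt
  · exact Filter.Eventually.of_forall
      (fun z => Continuous.aestronglyMeasurable (by fun_prop))
  · exact Continuous.intervalIntegrable (by fun_prop) _ _
  · exact Continuous.aestronglyMeasurable (by fun_prop)
  · exact Filter.Eventually.of_forall
      (fun s hs z hz => hB (z, s) ⟨hz, Set.uIoc_subset_uIcc hs⟩)
  · exact intervalIntegrable_const
  · refine Filter.Eventually.of_forall (fun s _ z _ => ?_)
    have := ((hφ (z + s)).hasDerivAt.comp_add_const z (s:ℂ))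
    exact this.mul_const _

lemma pw_conv_type {φ : ℂ → ℂ} {A : ℝ} (hA : 0 ≤ A) (ht : PWType φ A)
    {g : ℝ → ℂ} (hg : Continuous g)
    (a b : ℝ) : PWType (fun z => ∫ s in a..b, φ (z + s) * g s) A := by
  intro η hη
  obtain ⟨C, hC0, hC⟩ := ht.nn η hη
  obtain ⟨B, hB⟩ : ∃ B, ∀ s ∈ Set.uIcc a b, ‖g s‖ ≤ B :=
    isCompact_uIcc.exists_bound_of_continuousOn hg.continuousOn
  have hB0 : 0 ≤ B := (norm_nonneg _).trans (hB a Set.left_mem_uIcc)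
  obtain ⟨K, hK⟩ : ∃ K, ∀ s ∈ Set.uIcc a b, ‖((s:ℝ):ℂ)‖ ≤ K :=
    isCompact_uIcc.exists_bound_of_continuousOn (by fun_prop)
  refine ⟨C * Real.exp ((A + η) * K) * B * |b - a|, fun z => ?_⟩
  have := intervalIntegral.norm_integral_le_of_norm_le_const (a := a) (b := b)
    (f := fun s : ℝ => φ (z + s) * g s)
    (C := C * Real.exp ((A + η) * (‖z‖ + K)) * B) ?_
  · refine this.trans (le_of_eq ?_)
    rw [mul_add, Real.exp_add]; ring
  · intro s hs
    have hs := Set.uIoc_subset_uIcc hs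
    rw [norm_mul]
    gcongr
    · refine (hC _).trans ?_
      gcongr
      exact (norm_add_le _ _).trans (by gcongr; exact hK s hs)
    · exact hB s hs

/-- Plancherel–Pólya. -/
lemma pw_PP {φ : ℂ → ℂ} {A : ℝ} (hA : 0 ≤ A) (hφ : Differentiable ℂ φ) (ht : PWType φ A)
    (hL2 : Integrable (fun x : ℝ => ‖φ (x : ℂ)‖ ^ 2)) (z : ℂ) (hz : z.im ≤ 0)
    {a b : ℝ} (hab : a ≤ b) :
    ∫ s in a..b, ‖φ (z + (s:ℝ))‖ ^ 2 ≤
      (∫ x : ℝ, ‖φ (x : ℂ)‖ ^ 2) * Real.exp (A * (-z.im)) ^ 2 := by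
  have hφc := hφ.continuous
  set E := ∫ x : ℝ, ‖φ (x : ℂ)‖ ^ 2 with hE
  set J := ∫ s in a..b, ‖φ (z + (s:ℝ))‖ ^ 2 with hJ
  have hE0 : 0 ≤ E := integral_nonneg (fun x => by positivity)
  have hJ0 : 0 ≤ J := intervalIntegral.integral_nonneg hab (fun x _ => by positivity)
  set g : ℝ → ℂ := fun s => (starRingEnd ℂ) (φ (z + (s:ℝ))) with hg
  have hgc : Continuous g := Complex.continuous_conj.comp (by fun_prop)
  have hgn : ∀ s, ‖g s‖ = ‖φ (z + (s:ℝ))‖ := fun s => by simp [hg]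
  have h := pw_PL (M := Real.sqrt (E * J)) hA (pw_conv_diff hφ hgc a b)
    (pw_conv_type hA ht hgc a b) ?_ z hz
  · have e : (∫ s in a..b, φ (z + s) * g s) = (J : ℂ) := by
      rw [hJ, ← intervalIntegral.integral_ofReal]
      congr 1
      funext s
      simp only [hg, Complex.mul_conj, Complex.normSq_eq_norm_sq]
    simp only [e] at h
    rw [Complex.norm_real, Real.norm_eq_abs, abs_of_nonneg hJ0] at h
    have h2 : J ^ 2 ≤ E * J * Real.exp (A * (-z.im)) ^ 2 := by
      calc J ^ 2 ≤ (Real.sqrt (E * J) * Real.exp (A * (-z.im))) ^ 2 := by gcongr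
        _ = _ := by rw [mul_pow, Real.sq_sqrt (by positivity)]
    rcases hJ0.eq_or_lt with h0 | h0
    · rw [← h0]; positivity
    · nlinarith
  · intro x
    refine Real.le_sqrt_of_sq_le ?_
    refine (pw_cs_norm (f := fun s : ℝ => φ (x + s)) (by fun_prop) hgc hab).trans ?_
    simp only [hgn]
    gcongr
    have : ∫ s in a..b, ‖φ ((x:ℂ) + (s:ℝ))‖ ^ 2 = ∫ s in (x+a)..(x+b), ‖φ ((s:ℝ):ℂ)‖ ^ 2 := by
      rw [← intervalIntegral.integral_comp_add_left (fun s : ℝ => ‖φ ((s:ℝ):ℂ)‖ ^ 2)]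
      simp
    rw [this, intervalIntegral.integral_of_le (by linarith)]
    exact setIntegral_le_integral hL2 (Filter.Eventually.of_forall (fun x => by positivity))

lemma pw_shift {h : ℝ → ℝ} (hi : Integrable h) (δ : ℝ) :
    Tendsto (fun R : ℝ => ∫ x in R..(R + δ), h x) atTop (nhds 0) ∧
    Tendsto (fun R : ℝ => ∫ x in (-R)..(-R + δ), h x) atTop (nhds 0) := by
  constructor
  · have h1 := intervalIntegral_tendsto_integral_Ioi (0:ℝ) hi.integrableOn
      (tendsto_id (α := ℝ) (x := atTop))
    have h2 := intervalIntegral_tendsto_integral_Ioi (0:ℝ) hi.integrableOn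
      (tendsto_atTop_add_const_right (atTop : Filter ℝ) δ tendsto_id)
    have := h2.sub h1
    rw [sub_self] at this
    refine this.congr (fun R => ?_)
    exact intervalIntegral.integral_interval_sub_left hi.intervalIntegrable hi.intervalIntegrable
  · have h1 := intervalIntegral_tendsto_integral_Iic (0:ℝ) hi.integrableOn
      (tendsto_neg_atTop_atBot (G := ℝ))
    have h2 := intervalIntegral_tendsto_integral_Iic (0:ℝ) hi.integrableOn
      (tendsto_atBot_add_const_right (atTop : Filter ℝ) δ (tendsto_neg_atTop_atBot (G := ℝ)))
    have := h1.sub h2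
    rw [sub_self] at this
    refine this.congr (fun R => ?_)
    rw [← intervalIntegral.integral_add_adjacent_intervals (a := -R) (b := -R + δ) (c := 0)
      hi.intervalIntegrable hi.intervalIntegrable]
    ring

lemma pw_line_int {φ : ℂ → ℂ} {A : ℝ} (hA : 0 ≤ A) (hφ : Differentiable ℂ φ) (ht : PWType φ A)
    (hL2 : Integrable (fun x : ℝ => ‖φ (x : ℂ)‖ ^ 2)) (y : ℝ) (hy : y ≤ 0) :
    Integrable (fun s : ℝ => ‖φ ((y:ℂ) * I + s)‖ ^ 2) := by
  have hφc := hφ.continuous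
  refine integrable_of_intervalIntegral_norm_bounded (a := fun R : ℝ => -R) (b := fun R => R)
    (l := atTop) ((∫ x : ℝ, ‖φ (x : ℂ)‖ ^ 2) * Real.exp (A * (-y)) ^ 2) ?_
    tendsto_neg_atTop_atBot tendsto_id ?_
  · intro R
    exact (Continuous.integrableOn_Icc (by fun_prop)).mono_set Set.Ioc_subset_Icc_self
  · filter_upwards [eventually_ge_atTop (0:ℝ)] with R hR
    have := pw_PP hA hφ ht hL2 ((y:ℂ) * I) (by simpa using hy) (a := -R) (b := R) (by linarith)
    simpa using this

lemma pw_contour {F : ℂ → ℂ} {A M t : ℝ} (hF : Differentiable ℂ F) (hM : 0 ≤ M)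
    (hb : ∀ z : ℂ, z.im ≤ 0 → ‖F z‖ ≤ M * Real.exp (A * (-z.im)))
    (h1 : ∀ y : ℝ, y ≤ 0 → Tendsto (fun R : ℝ => F ((R:ℝ) + y * I)) atTop (nhds 0))
    (h2 : ∀ y : ℝ, y ≤ 0 → Tendsto (fun R : ℝ => F (((-R : ℝ):ℂ) + y * I)) atTop (nhds 0))
    (ht : A < t) :
    Tendsto (fun R : ℝ => ∫ x in (-R)..R, F (x : ℂ) * cexp (-I * x * t)) atTop (nhds 0) := by
  have hFc := hF.continuous
  set f : ℂ → ℂ := fun z => F z * cexp (-I * z * t) with hf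
  have hfd : Differentiable ℂ f := hF.mul (by fun_prop)
  have hfc := hfd.continuous
  have hfn : ∀ x y : ℝ, ‖f (x + y * I)‖ = ‖F (x + y * I)‖ * Real.exp (t * y) := by
    intro x y
    simp only [hf, norm_mul, Complex.norm_exp]
    congr 2
    simp [mul_comm]
  have hfb : ∀ x y : ℝ, y ≤ 0 → ‖f (x + y * I)‖ ≤ M * Real.exp ((t - A) * y) := by
    intro x y hy
    rw [hfn]
    calc _ ≤ (M * Real.exp (A * (-y))) * Real.exp (t * y) := by
          gcongr
          simpa using hb (x + y * I) (by simpa using hy)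
      _ = _ := by
          rw [mul_assoc, ← Real.exp_add]; congr 2; ring
  have hexpint : IntegrableOn (fun y : ℝ => M * Real.exp ((t - A) * y)) (Set.Iic 0) :=
    (integrableOn_exp_mul_Iic (by linarith) 0).const_mul M
  have hint : ∀ x : ℝ, IntegrableOn (fun y : ℝ => ‖f (x + y * I)‖) (Set.Iic 0) := by
    intro x
    refine Integrable.mono' hexpint (Continuous.aestronglyMeasurable (by fun_prop)) ?_
    refine (ae_restrict_iff' measurableSet_Iic).2 (Eventually.of_forall fun y hy => ?_)
    simpa using hfb x y hy
  have hlim : ∀ u : ℝ → ℝ, (∀ y : ℝ, y ≤ 0 → Tendsto (fun R : ℝ => F ((u R : ℝ) + y * I)) atTop (nhds 0)) →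
      Tendsto (fun R : ℝ => ∫ y in Set.Iic (0:ℝ), ‖f ((u R : ℝ) + y * I)‖) atTop (nhds 0) := by
    intro u hu
    have := tendsto_integral_filter_of_dominated_convergence (μ := volume.restrict (Set.Iic (0:ℝ)))
      (l := atTop) (F := fun (R : ℝ) (y : ℝ) => ‖f ((u R : ℝ) + y * I)‖) (f := fun _ => (0:ℝ))
      (fun y : ℝ => M * Real.exp ((t - A) * y)) ?_ ?_ hexpint ?_
    · simpa using this
    · exact Eventually.of_forall fun R => Continuous.aestronglyMeasurable (by fun_prop)
    · refine Eventually.of_forall fun R => ?_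
      refine (ae_restrict_iff' measurableSet_Iic).2 (Eventually.of_forall fun y hy => ?_)
      simpa using hfb (u R) y hy
    · refine (ae_restrict_iff' measurableSet_Iic).2 (Eventually.of_forall fun y hy => ?_)
      simp only [hfn]
      simpa using ((hu y hy).norm.mul_const (Real.exp (t * y)))
  have hsum := (hlim (fun R => R) h1).add (hlim (fun R => -R) h2)
  rw [add_zero] at hsum
  refine squeeze_zero_norm' ?_ hsum
  filter_upwards [eventually_ge_atTop (0:ℝ)] with R hR
  have hside : ∀ x Y : ℝ, 0 ≤ Y → ‖I • ∫ y in (-Y)..0, f (x + y * I)‖ ≤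
      ∫ y in Set.Iic (0:ℝ), ‖f (x + y * I)‖ := by
    intro x Y hY
    rw [norm_smul, Complex.norm_I, one_mul]
    refine (intervalIntegral.norm_integral_le_integral_norm (by linarith)).trans ?_
    rw [intervalIntegral.integral_of_le (by linarith)]
    exact setIntegral_mono_set (hint x) (Eventually.of_forall fun _ => norm_nonneg _)
      (Eventually.of_forall (fun y (hy : y ∈ Set.Ioc (-Y) 0) => hy.2))
  have hY : ∀ Y : ℝ, 0 ≤ Y → ‖∫ x in (-R)..R, f (x:ℂ)‖ ≤
      ((∫ y in Set.Iic (0:ℝ), ‖f ((R : ℝ) + y * I)‖) +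
      ∫ y in Set.Iic (0:ℝ), ‖f (((-R : ℝ):ℂ) + y * I)‖)
       + M * Real.exp ((t - A) * (-Y)) * |R - (-R)| := by
    intro Y hY
    have hrect := integral_boundary_rect_eq_zero_of_differentiableOn f
      (⟨-R, -Y⟩ : ℂ) (⟨R, 0⟩ : ℂ) hfd.differentiableOn
    simp only [Complex.ofReal_zero, zero_mul, add_zero] at hrect
    have e : (∫ x in (-R)..R, f (x:ℂ)) = (∫ x in (-R)..R, f (x + ((-Y:ℝ):ℂ) * I))
        + (I • ∫ y in (-Y)..0, f (R + y * I)) - (I • ∫ y in (-Y)..0, f (((-R : ℝ):ℂ) + y * I)) := by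
      linear_combination -hrect
    rw [e]
    have hbot : ‖∫ x in (-R)..R, f (x + ((-Y:ℝ):ℂ) * I)‖ ≤
        M * Real.exp ((t - A) * (-Y)) * |R - (-R)| :=
      intervalIntegral.norm_integral_le_of_norm_le_const
        (fun x _ => hfb x (-Y) (by linarith))
    have := norm_sub_le ((∫ x in (-R)..R, f (x + ((-Y:ℝ):ℂ) * I))
        + (I • ∫ y in (-Y)..0, f (R + y * I))) (I • ∫ y in (-Y)..0, f (((-R : ℝ):ℂ) + y * I))
    have := norm_add_le (∫ x in (-R)..R, f (x + ((-Y:ℝ):ℂ) * I))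
        (I • ∫ y in (-Y)..0, f (R + y * I))
    have := hside R Y hY
    have := hside (-R) Y hY
    linarith
  have hYlim : Tendsto (fun Y : ℝ => ((∫ y in Set.Iic (0:ℝ), ‖f ((R : ℝ) + y * I)‖) +
      ∫ y in Set.Iic (0:ℝ), ‖f (((-R : ℝ):ℂ) + y * I)‖)
       + M * Real.exp ((t - A) * (-Y)) * |R - (-R)|) atTop (nhds (((∫ y in Set.Iic (0:ℝ), ‖f ((R : ℝ) + y * I)‖) +
      ∫ y in Set.Iic (0:ℝ), ‖f (((-R : ℝ):ℂ) + y * I)‖)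
       + M * 0 * |R - (-R)|)) := by
    refine Tendsto.const_add _ (Tendsto.mul_const _ (Tendsto.const_mul _ ?_))
    exact Real.tendsto_exp_atBot.comp
      (tendsto_neg_atTop_atBot.const_mul_atBot (by linarith))
  have := ge_of_tendsto hYlim ((eventually_ge_atTop 0).mono hY)
  rw [mul_zero, zero_mul, add_zero] at this
  exact this

lemma pw_small {h : ℝ → ℂ} (hc : Continuous h) (a : ℝ) {s δ : ℝ} (hs : 0 ≤ s) (hsδ : s ≤ δ) :
    ‖∫ x in a..(a + s), h x‖ ≤ Real.sqrt ((∫ x in a..(a + δ), ‖h x‖ ^ 2) * δ) := by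
  refine Real.le_sqrt_of_sq_le ?_
  have := pw_cs_norm (g := fun _ => 1) hc continuous_const (show a ≤ a + s by linarith)
  simp only [mul_one, norm_one, one_pow, intervalIntegral.integral_const, smul_eq_mul,
    add_sub_cancel_left] at this
  refine this.trans ?_
  have h0 : 0 ≤ ∫ x in a..(a + δ), ‖h x‖ ^ 2 :=
    intervalIntegral.integral_nonneg (by linarith) (fun x _ => by positivity)
  refine mul_le_mul ?_ hsδ hs h0
  refine intervalIntegral.integral_mono_interval le_rfl (by linarith) (by linarith)
    (Eventually.of_forall fun x => by positivity) (Continuous.intervalIntegrable (by fun_prop) _ _)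

lemma pw_average {h m : ℝ → ℂ} (hc : Continuous h) (hL2 : Integrable (fun x => ‖h x‖ ^ 2))
    (hm : Continuous m) (hm1 : ∀ s, ‖m s‖ ≤ 1) {δ : ℝ} (hδ : 0 ≤ δ)
    (hne : ∫ s in (0:ℝ)..δ, m s ≠ 0)
    (hlim : Tendsto (fun R : ℝ => ∫ x in (-R)..R, ∫ s in (0:ℝ)..δ, h (x + s) * m s) atTop (nhds 0)) :
    Tendsto (fun R : ℝ => ∫ x in (-R)..R, h x) atTop (nhds 0) := by
  have hI : ∀ a b, IntervalIntegrable h volume a b := fun a b => hc.intervalIntegrable a b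
  have e1 : ∀ R : ℝ, (∫ x in (-R)..R, ∫ s in (0:ℝ)..δ, h (x + s) * m s) =
      ∫ s in (0:ℝ)..δ, (∫ x in (-R + s)..(R + s), h x) * m s := by
    intro R
    rw [intervalIntegral_intervalIntegral_swap]
    · congr 1; funext s
      rw [intervalIntegral.integral_mul_const,
        intervalIntegral.integral_comp_add_right (fun x => h x)]
    · refine IntegrableOn.mono_set (t := Set.uIcc (-R) R ×ˢ Set.uIcc 0 δ) ?_
        (Set.prod_mono Set.uIoc_subset_uIcc Set.uIoc_subset_uIcc)
      refine ContinuousOn.integrableOn_compact (isCompact_uIcc.prod isCompact_uIcc) ?_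
      exact Continuous.continuousOn (by unfold Function.uncurry; fun_prop)
  have hcont : ∀ R : ℝ, Continuous (fun s => (∫ x in (-R + s)..(R + s), h x)) := by
    intro R
    have hp : Continuous (fun b => ∫ x in (0:ℝ)..b, h x) :=
      intervalIntegral.continuous_primitive hI 0
    have : (fun s => (∫ x in (-R + s)..(R + s), h x)) =
        fun s => (∫ x in (0:ℝ)..(R + s), h x) - ∫ x in (0:ℝ)..(-R + s), h x := by
      funext s
      exact (intervalIntegral.integral_interval_sub_left (hI _ _) (hI _ _)).symm
    rw [this]
    exact (hp.comp (by fun_prop)).sub (hp.comp (by fun_prop))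
  set ε : ℝ → ℝ := fun R => Real.sqrt ((∫ x in R..(R + δ), ‖h x‖ ^ 2) * δ) +
    Real.sqrt ((∫ x in (-R)..(-R + δ), ‖h x‖ ^ 2) * δ) with hε
  have hεlim : Tendsto (fun R => ε R * |δ - 0|) atTop (nhds 0) := by
    have h1 := ((pw_shift hL2 δ).1.mul_const δ).sqrt
    have h2 := ((pw_shift hL2 δ).2.mul_const δ).sqrt
    have := (h1.add h2).mul_const |δ - 0|
    simpa using this
  have hdiff : Tendsto (fun R : ℝ => (∫ x in (-R)..R, ∫ s in (0:ℝ)..δ, h (x + s) * m s) -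
      (∫ x in (-R)..R, h x) * ∫ s in (0:ℝ)..δ, m s) atTop (nhds 0) := by
    refine squeeze_zero_norm (fun R => ?_) hεlim
    rw [e1, ← intervalIntegral.integral_const_mul, ← intervalIntegral.integral_sub
      (Continuous.intervalIntegrable (by have := hcont R; fun_prop) _ _)
      (Continuous.intervalIntegrable (by fun_prop) _ _)]
    refine intervalIntegral.norm_integral_le_of_norm_le_const (fun s hs => ?_)
    rw [Set.uIoc_of_le hδ] at hs
    rw [← sub_mul, norm_mul]
    have e2 : (∫ x in (-R + s)..(R + s), h x) - (∫ x in (-R)..R, h x) =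
        (∫ x in R..(R + s), h x) - ∫ x in (-R)..(-R + s), h x := by
      have a1 := intervalIntegral.integral_add_adjacent_intervals (hI (-R) (-R+s)) (hI (-R+s) (R+s))
      have a2 := intervalIntegral.integral_add_adjacent_intervals (hI (-R) R) (hI R (R+s))
      linear_combination a1 - a2
    rw [e2]
    refine (mul_le_of_le_one_right (norm_nonneg _) (hm1 s)).trans ((norm_sub_le _ _).trans ?_)
    exact add_le_add (pw_small hc R hs.1.le hs.2) (pw_small hc (-R) hs.1.le hs.2)
  have h3 := (hlim.sub hdiff).div_const (∫ s in (0:ℝ)..δ, m s)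
  simp only [sub_zero, zero_div] at h3
  refine h3.congr (fun R => ?_)
  field_simp
  ring

lemma pw_half {φ : ℂ → ℂ} {A : ℝ} (hA : 0 ≤ A) (hφ : Differentiable ℂ φ) (hty : PWType φ A)
    (hL2 : Integrable (fun x : ℝ => ‖φ (x : ℂ)‖ ^ 2)) {t : ℝ} (ht : A < t) :
    Tendsto (fun R : ℝ => ∫ x in (-R)..R, φ (x : ℂ) * cexp (-I * x * t)) atTop (nhds 0) := by
  have hφc := hφ.continuous
  have ht0 : 0 < t := hA.trans_lt ht
  set δ : ℝ := Real.pi / t with hδ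
  have hδ0 : 0 < δ := div_pos Real.pi_pos ht0
  set F : ℂ → ℂ := fun z => ∫ s in (0:ℝ)..δ, φ (z + s) * 1 with hF
  have hFd : Differentiable ℂ F := pw_conv_diff hφ (g := fun _ => 1) continuous_const 0 δ
  have hFn : ∀ z, ‖F z‖ ≤ Real.sqrt ((∫ s in (0:ℝ)..δ, ‖φ (z + s)‖ ^ 2) * δ) := by
    intro z
    have := pw_small (h := fun s : ℝ => φ (z + s)) (by fun_prop) 0 hδ0.le le_rfl
    simpa [hF] using this
  have hside : ∀ (u : ℝ → ℝ), (∀ h : ℝ → ℝ, Integrable h →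
      Tendsto (fun R : ℝ => ∫ x in (u R)..(u R + δ), h x) atTop (nhds 0)) →
      ∀ y : ℝ, y ≤ 0 → Tendsto (fun R : ℝ => F ((u R : ℝ) + y * I)) atTop (nhds 0) := by
    intro u hu y hy
    have h1 := ((hu _ (pw_line_int hA hφ hty hL2 y hy)).mul_const δ).sqrt
    rw [zero_mul, Real.sqrt_zero] at h1
    refine squeeze_zero_norm (fun R => ?_) h1
    refine (hFn _).trans (le_of_eq ?_)
    congr 2
    have := intervalIntegral.integral_comp_add_left (a := 0) (b := δ)
      (fun s : ℝ => ‖φ ((y:ℂ) * I + s)‖ ^ 2) (u R)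
    rw [add_zero] at this
    rw [← this]
    congr 1; funext s
    congr 3
    push_cast; ring
  have hcont := pw_contour (F := F) (A := A) (t := t)
    (M := Real.sqrt ((∫ x : ℝ, ‖φ (x : ℂ)‖ ^ 2) * δ)) hFd (Real.sqrt_nonneg _) ?_
    (hside (fun R => R) fun h hi => (pw_shift hi δ).1)
    (hside (fun R => -R) fun h hi => (pw_shift hi δ).2) ht
  · refine pw_average (h := fun x : ℝ => φ x * cexp (-I * x * t)) (m := fun s : ℝ => cexp (I * s * t))
      (δ := δ) (by fun_prop) ?_ (by fun_prop) ?_ hδ0.le ?_ ?_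
    · refine hL2.congr (Eventually.of_forall fun x => ?_)
      simp [Complex.norm_exp]
    · intro s
      simp [Complex.norm_exp]
    · have e : ∀ s : ℝ, cexp (I * s * t) = cexp ((I * t) * s) := fun s => by congr 1; ring
      have hIt : I * (t:ℂ) ≠ 0 := mul_ne_zero I_ne_zero (by exact_mod_cast ht0.ne')
      simp only [e]
      rw [integral_exp_mul_complex hIt]
      have : I * (t:ℂ) * (δ:ℝ) = Real.pi * I := by
        rw [hδ]; push_cast
        have : (t:ℂ) ≠ 0 := by exact_mod_cast ht0.ne'
        field_simp
      rw [this, Complex.exp_pi_mul_I]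
      refine div_ne_zero ?_ hIt
      simp; norm_num
    · refine hcont.congr (fun R => ?_)
      congr 1; funext x
      simp only [hF]
      rw [← intervalIntegral.integral_mul_const]
      congr 1; funext s
      rw [mul_one, mul_assoc (φ _), ← Complex.exp_add]
      push_cast
      congr 2
      ring
  · intro z hz
    refine (hFn z).trans ?_
    rw [← Real.sqrt_sq (Real.exp_pos (A * (-z.im))).le, ← Real.sqrt_mul' _ (by positivity)]
    refine Real.sqrt_le_sqrt ?_
    have := pw_PP hA hφ hty hL2 z hz hδ0.le
    calc _ ≤ _ := mul_le_mul_of_nonneg_right this hδ0.le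
      _ = _ := by ring

/-- Paley–Wiener: an entire function of exponential type A which is square
integrable on the real line has Fourier transform supported in [-A, A]:
for almost every t with |t| > A, the (symmetric improper) Fourier integral
∫ φ(x) e^{-ixt} dx vanishes. -/
theorem paley_wiener_support
    (φ : ℂ → ℂ) (A : ℝ) (hA : 0 ≤ A) (hφ : Differentiable ℂ φ)
    (htype : ∀ η > (0:ℝ), ∃ C : ℝ, ∀ z : ℂ, ‖φ z‖ ≤ C * Real.exp ((A + η) * ‖z‖))
    (hL2 : Integrable (fun x : ℝ => ‖φ (x : ℂ)‖ ^ 2)) :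
    ∀ᵐ t : ℝ, A < |t| →
      Tendsto (fun R : ℝ => ∫ x in (-R)..R, φ (x : ℂ) * Complex.exp (-Complex.I * x * t))
        atTop (nhds 0) := by
  refine Eventually.of_forall fun t ht => ?_
  rcases lt_abs.1 ht with h | h
  · exact pw_half hA hφ htype hL2 h
  · have hψ := pw_half (φ := fun z => φ (-z)) (A := A) (t := -t) hA (hφ.comp differentiable_neg)
      (fun η hη => ?_) ?_ h
    · refine hψ.congr (fun R => ?_)
      have := intervalIntegral.integral_comp_neg (a := -R) (b := R)
        (fun x : ℝ => φ (x : ℂ) * Complex.exp (-Complex.I * x * t))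
      rw [neg_neg] at this
      rw [← this]
      congr 1; funext x
      push_cast
      congr 2
      ring
    · obtain ⟨C, hC⟩ := htype η hη
      exact ⟨C, fun z => by simpa using hC (-z)⟩
    · simpa using hL2.comp_neg
end

section
/- Let \epsilon > 0 and let S(x) be a positive increasing function with \int_0^\infty \log S(x)/(1+x^2) dx < \infty. Then there exists a continuous function f, not identically zero, with support contained in [0, \epsilon], such that \hat f(0) \neq 0 and |\hat f(t)| \le 1/S(|t|) for all real t (up to a positive constant factor). -/
open MeasureTheory Filter Complex

open scoped Topology in
lemma pw_factor (s : ℝ) :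
    ‖∫ u : unitInterval, Complex.exp (-Complex.I * ((s * (u : ℝ) : ℝ) : ℂ))‖ ≤ 1 := by
  refine (norm_integral_le_of_norm_le_const (C := 1) (Eventually.of_forall fun u => ?_)).trans ?_
  · rw [Complex.norm_exp]; simp
  · simp

lemma pw_factor' (s : ℝ) (hs : s ≠ 0) :
    ‖∫ u : unitInterval, Complex.exp (-Complex.I * ((s * (u : ℝ) : ℝ) : ℂ))‖ ≤ 2 / |s| := by
  have h1 : ∫ u : unitInterval, Complex.exp (-Complex.I * ((s * (u : ℝ) : ℝ) : ℂ))
      = ∫ u in (0:ℝ)..1, Complex.exp ((-Complex.I * s) * u) := by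
    rw [intervalIntegral.integral_of_le zero_le_one, ← integral_Icc_eq_integral_Ioc]
    have := integral_subtype_comap (μ := (volume : Measure ℝ)) (s := Set.Icc (0:ℝ) 1)
      measurableSet_Icc (fun u : ℝ => Complex.exp ((-Complex.I * s) * u))
    rw [← this]
    refine integral_congr_ae (Eventually.of_forall fun u => ?_)
    simp [mul_assoc]
  have hc : (-Complex.I * s) ≠ 0 := by simp [hs]
  rw [h1, integral_exp_mul_complex hc, norm_div]
  have h2 : ‖(-Complex.I * s : ℂ)‖ = |s| := by simp
  rw [h2]
  gcongr
  refine (norm_sub_le _ _).trans ?_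
  rw [Complex.norm_exp, Complex.norm_exp]
  norm_num

lemma pw_random {ι : Type} [Countable ι] (a : ι → ℝ) (ha : ∀ i, 0 < a i) (hs : Summable a) :
    ∃ (Ω : Type) (_ : MeasurableSpace Ω) (P : Measure Ω) (_ : IsProbabilityMeasure P)
      (X : Ω → ℝ), Measurable X ∧ (∀ ω, 0 ≤ X ω) ∧ (∀ ω, X ω ≤ ∑' i, a i) ∧
      ∀ (B : Finset ι) (t : ℝ), t ≠ 0 →
        ‖∫ ω, Complex.exp (-Complex.I * ((t * X ω : ℝ) : ℂ)) ∂P‖ ≤ ∏ i ∈ B, 2 / (a i * |t|) := by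
  classical
  have hsum : ∀ ω : ι → unitInterval, Summable fun i => a i * (ω i : ℝ) := fun ω =>
    Summable.of_nonneg_of_le (fun i => mul_nonneg (ha i).le (ω i).2.1)
      (fun i => mul_le_of_le_one_right (ha i).le (ω i).2.2) hs
  have hmeas : ∀ s : Finset ι, Measurable fun ω : ι → unitInterval => ∑ i ∈ s, a i * (ω i : ℝ) := by
    intro s
    fun_prop
  have hX : Measurable fun ω : ι → unitInterval => ∑' i, a i * (ω i : ℝ) := by
    refine measurable_of_tendsto_metrizable' (atTop : Filter (Finset ι)) hmeas ?_
    rw [tendsto_pi_nhds]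
    exact fun ω => (hsum ω).hasSum
  let P : Measure (ι → unitInterval) := Measure.infinitePi fun _ => (volume : Measure unitInterval)
  refine ⟨ι → unitInterval, inferInstance, P, inferInstance,
    fun ω => ∑' i, a i * (ω i : ℝ), hX, fun ω => tsum_nonneg fun i => mul_nonneg (ha i).le (ω i).2.1,
    fun ω => (hsum ω).tsum_le_tsum (fun i => mul_le_of_le_one_right (ha i).le (ω i).2.2) hs, ?_⟩
  intro B t ht
  have hprod : ∀ s : Finset ι,
      ∫ ω, Complex.exp (-Complex.I * ((t * ∑ i ∈ s, a i * (ω i : ℝ) : ℝ) : ℂ)) ∂P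
      = ∏ i ∈ s, ∫ u : unitInterval, Complex.exp (-Complex.I * (((t * a i) * (u : ℝ) : ℝ) : ℂ)) := by
    intro s
    have hind : ProbabilityTheory.iIndepFun (fun (i : ι) (ω : ι → unitInterval) => ω i) P :=
      ProbabilityTheory.iIndepFun_infinitePi (X := fun _ u => u) (fun _ => measurable_id)
    have hind' : ProbabilityTheory.iIndepFun (fun (i : s) (ω : ι → unitInterval) => ω i) P :=
      hind.precomp Subtype.val_injective
    have := hind'.integral_fun_prod_comp
      (f := fun (i : s) (u : unitInterval) =>
        Complex.exp (-Complex.I * (((t * a i) * (u : ℝ) : ℝ) : ℂ)))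
      (fun i => (measurable_pi_apply _).aemeasurable)
      (fun i => (by fun_prop : Continuous fun (u : unitInterval) =>
        Complex.exp (-Complex.I * (((t * a i) * (u : ℝ) : ℝ) : ℂ))).aestronglyMeasurable)
    rw [← Finset.prod_coe_sort]
    have h2 : ∀ i : s, ∫ ω, Complex.exp (-Complex.I * (((t * a i) * (ω (i : ι) : ℝ) : ℝ) : ℂ)) ∂P
        = ∫ u : unitInterval, Complex.exp (-Complex.I * (((t * a i) * (u : ℝ) : ℝ) : ℂ)) := by
      intro i
      have hm := measurePreserving_eval_infinitePi
        (fun _ : ι => (volume : Measure unitInterval)) (i : ι)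
      rw [← hm.map_eq, integral_map (measurable_pi_apply _).aemeasurable]
      · exact (by fun_prop : Continuous fun (u : unitInterval) =>
          Complex.exp (-Complex.I * (((t * a i) * (u : ℝ) : ℝ) : ℂ))).aestronglyMeasurable
    rw [← Finset.prod_congr rfl fun i _ => h2 i, ← this]
    refine integral_congr_ae (Eventually.of_forall fun ω => ?_)
    simp only
    rw [← Complex.exp_sum, ← Finset.mul_sum, ← Complex.ofReal_sum, ← Finset.sum_coe_sort,
      Finset.mul_sum]
    simp only [mul_assoc]
  have hlim : Tendsto (fun s : Finset ι =>
      ∫ ω, Complex.exp (-Complex.I * ((t * ∑ i ∈ s, a i * (ω i : ℝ) : ℝ) : ℂ)) ∂P) atTop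
      (nhds (∫ ω, Complex.exp (-Complex.I * ((t * ∑' i, a i * (ω i : ℝ) : ℝ) : ℂ)) ∂P)) := by
    refine tendsto_integral_filter_of_dominated_convergence (fun _ => 1) ?_ ?_ ?_ ?_
    · refine Eventually.of_forall fun s => Measurable.aestronglyMeasurable ?_
      have := hmeas s
      fun_prop
    · refine Eventually.of_forall fun s => Eventually.of_forall fun ω => ?_
      rw [Complex.norm_exp]; simp
    · exact integrable_const _
    · refine Eventually.of_forall fun ω => ?_
      have hc : Continuous fun x : ℝ => Complex.exp (-Complex.I * ((t * x : ℝ) : ℂ)) := by fun_prop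
      exact (hc.tendsto _).comp (hsum ω).hasSum
  refine le_of_tendsto hlim.norm ?_
  filter_upwards [eventually_ge_atTop B] with s hBs
  rw [hprod, norm_prod, ← Finset.prod_sdiff hBs]
  calc _ ≤ 1 * ∏ i ∈ B, 2 / (a i * |t|) := by
        refine mul_le_mul (Finset.prod_le_one (fun _ _ => norm_nonneg _) fun i _ => pw_factor _)
          (Finset.prod_le_prod (fun _ _ => norm_nonneg _) fun i _ => ?_)
          (Finset.prod_nonneg fun _ _ => norm_nonneg _) zero_le_one
        refine (pw_factor' _ (mul_ne_zero ht (ha i).ne')).trans_eq ?_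
        rw [abs_mul, abs_of_pos (ha i), mul_comm]
    _ = _ := one_mul _

lemma pw_summable (S : ℝ → ℝ) (hpos : ∀ x, 0 < S x) (hmono : MonotoneOn S (Set.Ici 0))
    (hint : IntegrableOn (fun x => Real.log (S x) / (1 + x ^ 2)) (Set.Ici 0)) :
    Summable fun j : ℕ => max (Real.log (S (2 ^ j))) 0 / 2 ^ j := by
  set F : ℝ → ℝ := fun x => max (Real.log (S x) / (1 + x ^ 2)) 0 with hF
  have hFi : IntegrableOn F (Set.Ici 0) := hint.pos_part
  set A : ℕ → Set ℝ := fun j => Set.Ico ((2:ℝ) ^ j) (2 ^ (j + 1)) with hA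
  have hAsub : ∀ j, A j ⊆ Set.Ici 0 := fun j x hx => le_trans (by positivity) hx.1
  have hdisj : Pairwise (Function.onFun Disjoint A) := by
    have hm : Monotone fun j : ℕ => (2:ℝ) ^ j := pow_right_mono₀ one_le_two
    exact hm.pairwise_disjoint_on_Ico_succ
  have hsum := (hasSum_integral_iUnion (f := F) (μ := volume) (fun j => measurableSet_Ico) hdisj
    (hFi.mono_set (Set.iUnion_subset hAsub))).summable
  refine Summable.of_nonneg_of_le (fun j => by positivity) (fun j => ?_) (hsum.mul_left 5)
  set m := max (Real.log (S (2 ^ j))) 0 with hm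
  have hm0 : 0 ≤ m := le_max_right _ _
  have hlow : ∀ x ∈ A j, m / (5 * (2 ^ j) ^ 2) ≤ F x := by
    intro x hx
    have hx1 : (2:ℝ) ^ j ≤ x := hx.1
    have hx2 : x < 2 ^ j * 2 := by have := hx.2; rwa [pow_succ] at this
    have hp : (1:ℝ) ≤ 2 ^ j := one_le_pow₀ one_le_two
    have hx0 : (0:ℝ) ≤ x := by linarith
    have hle : Real.log (S (2 ^ j)) ≤ Real.log (S x) :=
      Real.log_le_log (hpos _) (hmono (by simp) hx0 hx1)
    have hF' : F x = max (Real.log (S x)) 0 / (1 + x ^ 2) := by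
      simp only [hF]
      rw [← max_div_div_right (by positivity), zero_div]
    rw [hF']
    have h5 : 1 + x ^ 2 ≤ 5 * (2 ^ j) ^ 2 := by nlinarith
    exact div_le_div₀ (le_max_right _ _) (max_le_max_right _ hle) (by positivity) h5
  have := setIntegral_mono_on (μ := volume) (s := A j) (f := fun _ => m / (5 * (2 ^ j) ^ 2)) (g := F)
    (by simp [hA]) (hFi.mono_set (hAsub j)) measurableSet_Ico hlow
  have hv : ∫ x in A j, m / (5 * (2 ^ j) ^ 2) = m / 2 ^ j / 5 := by
    rw [setIntegral_const]
    have : volume.real (A j) = 2 ^ j := by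
      simp only [hA]
      rw [Real.volume_real_Ico_of_le (by gcongr <;> simp)]
      ring
    rw [this, smul_eq_mul]
    field_simp
  rw [hv] at this
  linarith

lemma pw_smooth {Ω : Type} [MeasurableSpace Ω] (P : Measure Ω) [IsProbabilityMeasure P]
    (X : Ω → ℝ) (hX : Measurable X) (δ : ℝ) (hδ : 0 < δ) (h0 : ∀ ω, 0 ≤ X ω)
    (h1 : ∀ ω, X ω ≤ δ) :
    ∃ f : ℝ → ℂ, Continuous f ∧ tsupport f ⊆ Set.Icc 0 (2 * δ) ∧ (∫ x : ℝ, f x) ≠ 0 ∧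
      ∃ G > (0:ℝ), ∀ t : ℝ, ‖∫ x : ℝ, f x * Complex.exp (-Complex.I * x * t)‖ ≤
        G * ‖∫ ω, Complex.exp (-Complex.I * ((t * X ω : ℝ) : ℂ)) ∂P‖ := by
  set g : ℝ → ℝ := fun x => max 0 (min x (δ - x)) with hg
  have hgc : Continuous g := by fun_prop
  have hgn : ∀ x, 0 ≤ g x := fun x => le_max_left _ _
  have hgδ : ∀ x, g x ≤ δ := by
    intro x
    refine max_le hδ.le ?_
    rcases le_total x δ with h | h
    · exact (min_le_left _ _).trans h
    · exact (min_le_right _ _).trans (by linarith)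
  have hgz : ∀ x, x ∉ Set.Icc 0 δ → g x = 0 := by
    intro x hx
    refine max_eq_left ?_
    by_contra hcon
    push Not at hcon
    exact hx ⟨(lt_min_iff.1 hcon).1.le, by linarith [(lt_min_iff.1 hcon).2]⟩
  have hgcs : HasCompactSupport g := HasCompactSupport.intro isCompact_Icc hgz
  have hgi : Integrable g := hgc.integrable_of_hasCompactSupport hgcs
  have hGpos : 0 < ∫ x, g x := by
    refine hgc.integral_pos_of_hasCompactSupport_nonneg_nonzero hgcs hgn (x := δ / 2) ?_
    have : g (δ / 2) = δ / 2 := by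
      simp only [hg]
      rw [show δ - δ / 2 = δ / 2 by ring, min_self, max_eq_right (by positivity)]
    rw [this]; positivity
  have hmj : Measurable fun p : ℝ × Ω => g (p.1 - X p.2) := by
    have := hgc.measurable
    fun_prop
  set f : ℝ → ℂ := fun x => ((∫ ω, g (x - X ω) ∂P : ℝ) : ℂ) with hf
  have hfr : Continuous fun x => ∫ ω, g (x - X ω) ∂P := by
    refine continuous_of_dominated (bound := fun _ => δ) ?_ ?_ (integrable_const _) ?_
    · intro x
      exact (hgc.measurable.comp (measurable_const.sub hX)).aestronglyMeasurable
    · intro x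
      refine Eventually.of_forall fun ω => ?_
      rw [Real.norm_of_nonneg (hgn _)]; exact hgδ _
    · exact Eventually.of_forall fun ω => by fun_prop
  have hsuppz : ∀ x, x ∉ Set.Icc 0 (2 * δ) → ∀ ω, g (x - X ω) = 0 := by
    intro x hx ω
    refine hgz _ fun h => hx ⟨?_, ?_⟩
    · linarith [h.1, h0 ω]
    · linarith [h.2, h1 ω]
  have key : ∀ t : ℝ, ∫ x : ℝ, f x * Complex.exp (-Complex.I * x * t) =
      (∫ ω, Complex.exp (-Complex.I * ((t * X ω : ℝ) : ℂ)) ∂P) *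
        ∫ x : ℝ, (g x : ℂ) * Complex.exp (-Complex.I * x * t) := by
    intro t
    have hprodint : Integrable (Function.uncurry fun (x : ℝ) (ω : Ω) =>
        (g (x - X ω) : ℂ) * Complex.exp (-Complex.I * x * t)) (volume.prod P) := by
      have hb : Integrable (fun p : ℝ × Ω => (Set.Icc 0 (2 * δ)).indicator (fun _ => δ) p.1)
          (volume.prod P) := by
        refine Integrable.comp_fst (f := (Set.Icc 0 (2 * δ)).indicator (fun _ => δ)) ?_ P
        rw [integrable_indicator_iff measurableSet_Icc]
        exact integrableOn_const measure_Icc_lt_top.ne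
      refine hb.mono' ?_ ?_
      · refine Measurable.aestronglyMeasurable ?_
        simp only [Function.uncurry_def]
        fun_prop
      · refine Eventually.of_forall fun p => ?_
        simp only [Function.uncurry_def]
        rw [norm_mul, Complex.norm_exp]
        by_cases hp : p.1 ∈ Set.Icc 0 (2 * δ)
        · rw [Set.indicator_of_mem hp]
          simp [abs_of_nonneg (hgn _), hgδ]
        · rw [Set.indicator_of_notMem hp, hsuppz _ hp]
          simp
    calc ∫ x : ℝ, f x * Complex.exp (-Complex.I * x * t)
        = ∫ x : ℝ, ∫ ω, (g (x - X ω) : ℂ) * Complex.exp (-Complex.I * x * t) ∂P := by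
          refine integral_congr_ae (Eventually.of_forall fun x => ?_)
          simp only [hf]
          rw [integral_mul_const, integral_complex_ofReal]
      _ = ∫ ω, (∫ x : ℝ, (g (x - X ω) : ℂ) * Complex.exp (-Complex.I * x * t)) ∂P :=
          integral_integral_swap hprodint
      _ = ∫ ω, Complex.exp (-Complex.I * ((t * X ω : ℝ) : ℂ)) *
            (∫ x : ℝ, (g x : ℂ) * Complex.exp (-Complex.I * x * t)) ∂P := by
          refine integral_congr_ae (Eventually.of_forall fun ω => ?_)
          simp only
          rw [← integral_const_mul,
            ← integral_sub_right_eq_self (fun x : ℝ => Complex.exp (-Complex.I * ((t * X ω : ℝ) : ℂ)) *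
              ((g x : ℂ) * Complex.exp (-Complex.I * x * t))) (X ω)]
          refine integral_congr_ae (Eventually.of_forall fun x => ?_)
          simp only
          rw [mul_left_comm, ← Complex.exp_add]
          congr 2
          push_cast
          ring
      _ = _ := integral_mul_const _ _
  refine ⟨f, Complex.continuous_ofReal.comp hfr, ?_, ?_, ∫ x, g x, hGpos, ?_⟩
  · refine closure_minimal ?_ isClosed_Icc
    intro x hx
    by_contra hcon
    refine hx ?_
    simp only [hf]
    simp [hsuppz x hcon]
  · have := key 0
    simp only [ofReal_zero, mul_zero, Complex.exp_zero, mul_one, zero_mul] at this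
    rw [this, integral_complex_ofReal]
    simp [hGpos.ne']
  · intro t
    rw [key, norm_mul, mul_comm]
    gcongr
    refine (norm_integral_le_integral_norm _).trans_eq ?_
    refine integral_congr_ae (Eventually.of_forall fun x => ?_)
    simp only
    rw [norm_mul, Complex.norm_exp]
    simp [abs_of_nonneg (hgn _)]

/-- Lemma 4: given ε > 0 and S positive increasing with convergent logarithmic
integral, there is a nonzero continuous function f supported in [0, ε] whose
Fourier transform satisfies f̂(0) ≠ 0 and |f̂(t)| ≤ c / S(|t|) for a constant
c > 0. -/
theorem paley_wiener_test_function
    (S : ℝ → ℝ) (hpos : ∀ x, 0 < S x) (hmono : MonotoneOn S (Set.Ici 0))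
    (hint : IntegrableOn (fun x => Real.log (S x) / (1 + x ^ 2)) (Set.Ici 0))
    (ε : ℝ) (hε : 0 < ε) :
    ∃ f : ℝ → ℂ, Continuous f ∧ f ≠ 0 ∧ tsupport f ⊆ Set.Icc 0 ε ∧
      (∫ x : ℝ, f x) ≠ 0 ∧
      ∃ c > (0:ℝ), ∀ t : ℝ,
        ‖∫ x : ℝ, f x * Complex.exp (-Complex.I * x * t)‖ ≤ c / S |t| := by
  set L : ℕ → ℝ := fun j => max (Real.log (S (2 ^ j))) 0 with hL
  set n : ℕ → ℕ := fun j => ⌈L (j + 1)⌉₊ with hn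
  set b : ℕ → ℝ := fun j => 2 * Real.exp 1 / 2 ^ j with hb
  have hbpos : ∀ j, 0 < b j := fun j => by simp only [hb]; positivity
  have hsL : Summable fun j : ℕ => L j / 2 ^ j := pw_summable S hpos hmono hint
  have hsn : Summable fun j => (n j : ℝ) * b j := by
    have h1 : Summable fun j : ℕ => L (j + 1) / 2 ^ (j + 1) := (summable_nat_add_iff 1).2 hsL
    have h2 : Summable fun j : ℕ => ((1:ℝ) / 2) ^ j := summable_geometric_two
    refine Summable.of_nonneg_of_le (fun j => mul_nonneg (Nat.cast_nonneg _) (hbpos j).le)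
      (fun j => ?_) ((h1.mul_left (4 * Real.exp 1)).add (h2.mul_left (2 * Real.exp 1)))
    have h3 : (n j : ℝ) ≤ L (j + 1) + 1 := (Nat.ceil_lt_add_one (le_max_right _ _)).le
    calc (n j : ℝ) * b j ≤ (L (j + 1) + 1) * b j := by gcongr
      _ = _ := by
        simp only [hb]
        rw [pow_succ, one_div, inv_pow]
        field_simp
        ring
  obtain ⟨J, hJ⟩ : ∃ J : ℕ, ∑' j, (n (j + J) : ℝ) * b (j + J) < ε / 2 :=
    ((tendsto_sum_nat_add fun j => (n j : ℝ) * b j).eventually (gt_mem_nhds (half_pos hε))).exists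
  let a : (Σ j : ℕ, Fin (n (j + J))) → ℝ := fun p => b (p.1 + J)
  have hinner : ∀ j, ∑' i : Fin (n (j + J)), a ⟨j, i⟩ = n (j + J) * b (j + J) := by
    intro j
    simp [a, tsum_fintype]
  have hsa : Summable a := by
    refine (summable_sigma_of_nonneg fun p => (hbpos _).le).2 ⟨fun j => (hasSum_fintype _).summable, ?_⟩
    refine Summable.congr ((summable_nat_add_iff J).2 hsn) fun j => (hinner j).symm
  have hsum : ∑' p, a p ≤ ε / 2 := by
    rw [hsa.tsum_sigma]
    simp only [hinner]
    exact hJ.le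
  obtain ⟨Ω, _, P, _, X, hX, hX0, hX1, hXB⟩ := pw_random a (fun p => hbpos _) hsa
  obtain ⟨f, hfc, hfs, hf0, G, hG, hfG⟩ :=
    pw_smooth P X hX (ε / 2) (half_pos hε) hX0 (fun ω => (hX1 ω).trans hsum)
  refine ⟨f, hfc, ?_, ?_, hf0, G * max 1 (S (2 ^ J)), by positivity, ?_⟩
  · rintro rfl
    simp at hf0
  · rwa [mul_div_cancel₀ _ two_ne_zero] at hfs
  intro t
  refine (hfG t).trans ?_
  rw [mul_div_assoc]
  gcongr
  rcases le_or_gt |t| (2 ^ J) with hle | hlt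
  · have h1 : ‖∫ ω, Complex.exp (-Complex.I * ((t * X ω : ℝ) : ℂ)) ∂P‖ ≤ 1 := by
      refine (norm_integral_le_of_norm_le_const (C := 1) (Eventually.of_forall fun u => ?_)).trans ?_
      · rw [Complex.norm_exp]; simp
      · simp
    refine h1.trans ?_
    rw [one_le_div (hpos _)]
    exact (hmono (abs_nonneg t) (by simp) hle).trans (le_max_right _ _)
  · have ht1 : 1 ≤ |t| := (one_le_pow₀ one_le_two).trans hlt.le
    have htpos : 0 < |t| := by linarith
    obtain ⟨m, hm1, hm2⟩ := exists_nat_pow_near ht1 (one_lt_two : (1:ℝ) < 2)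
    have hJm : J ≤ m := by
      have : (2:ℝ) ^ J < 2 ^ (m + 1) := hlt.trans hm2
      have := (pow_lt_pow_iff_right₀ (one_lt_two : (1:ℝ) < 2)).1 this
      omega
    obtain ⟨j, rfl⟩ : ∃ j, m = j + J := ⟨m - J, by omega⟩
    have hB := hXB (Finset.univ.map (Function.Embedding.sigmaMk j)) t (abs_pos.1 htpos)
    rw [Finset.prod_map] at hB
    simp only [Function.Embedding.sigmaMk_apply, a, Finset.prod_const, Finset.card_univ,
      Fintype.card_fin] at hB
    refine hB.trans ?_
    have hbase : 2 / (b (j + J) * |t|) ≤ Real.exp (-1) := by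
      rw [Real.exp_neg, div_le_iff₀ (mul_pos (hbpos _) htpos)]
      simp only [hb]
      rw [show (Real.exp 1)⁻¹ * (2 * Real.exp 1 / 2 ^ (j + J) * |t|) = 2 * (|t| / 2 ^ (j + J)) by
        field_simp]
      have : 1 ≤ |t| / 2 ^ (j + J) := (one_le_div (by positivity)).2 hm1
      linarith
    have hnn : 0 ≤ 2 / (b (j + J) * |t|) := by have := hbpos (j + J); positivity
    calc (2 / (b (j + J) * |t|)) ^ n (j + J) ≤ Real.exp (-1) ^ n (j + J) := by gcongr
      _ = Real.exp (-(n (j + J) : ℝ)) := by rw [← Real.exp_nat_mul]; simp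
      _ ≤ Real.exp (-Real.log (S (2 ^ (j + J + 1)))) := by
          gcongr
          exact (le_max_left _ _).trans (Nat.le_ceil (L (j + J + 1)))
      _ = 1 / S (2 ^ (j + J + 1)) := by rw [Real.exp_neg, Real.exp_log (hpos _), one_div]
      _ ≤ 1 / S |t| := by
          have := hmono (abs_nonneg t) (by simp) hm2.le
          exact one_div_le_one_div_of_le (hpos _) this
      _ ≤ _ := by
          have := hpos |t|
          gcongr
          exact le_max_left _ _
end

section
/- (Theorem 7, non-vanishing of zeta in short intervals near Re(s)=1) Suppose \omega(t) \le 1 is an increasing function with \int_2^\infty (1-\omega(t))/(t \log t) dt < \infty. Then for each \delta > 0 there exists C_\delta > 0 such that \int_T^{T+\delta} |\zeta(\sigma + it)| dt \ge C_\delta for all T \ge 2 and all \sigma \ge \omega(T). -/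
open MeasureTheory Filter Complex

/-- Quantitative boundary uniqueness in the right half plane. -/
lemma two_const (M x r : ℝ) (hM : 0 < M) (hx : 0 < x) (hr : 0 < r) :
    ∃ c > (0:ℝ), ∀ H : ℂ → ℂ, Differentiable ℂ H → (∀ z : ℂ, 0 ≤ z.re → ‖H z‖ ≤ M) →
      1/2 ≤ ‖H x‖ → ∀ ε : ℝ, (∀ y : ℝ, |y| ≤ r → ‖H (y * I)‖ ≤ ε) → c ≤ ε := by
  set η : ℝ := min x (r^2 / (4*x)) with hη
  have hη0 : 0 < η := by positivity
  have hηx : η ≤ x := min_le_left _ _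
  have hηr : η / r^2 ≤ 1/(4*x) := by
    have : η ≤ r^2 / (4*x) := min_le_right _ _
    rw [div_le_div_iff₀ (by positivity) (by positivity)]
    rw [le_div_iff₀ (by positivity)] at this
    linarith
  set M' : ℝ := max M 1 with hM'
  have hM1 : 1 ≤ M' := le_max_right _ _
  set l : ℝ := 4 * x * Real.log (4*M') with hl
  have hl0 : 0 ≤ l := by
    have := Real.log_nonneg (by linarith : (1:ℝ) ≤ 4*M')
    positivity
  refine ⟨8 * M'^2 * Real.exp (-(l/η)), by positivity, ?_⟩
  intro H hH hHM hHx ε hε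
  by_contra hlt
  push Not at hlt
  have hε0 : 0 ≤ ε := (norm_nonneg _).trans (hε 0 (by simpa using hr.le))
  have hne : ∀ z : ℂ, 0 ≤ z.re → z + η ≠ 0 := by
    intro z hz h
    have := congrArg Complex.re h
    simp at this
    linarith
  -- real part
  have hre : ∀ z : ℂ, 0 ≤ z.re → ((l:ℂ) / (z + η)).re ≤ l/η := by
    intro z hz
    refine (Complex.re_le_norm _).trans ?_
    rw [norm_div, Complex.norm_real, Real.norm_of_nonneg hl0]
    have : η ≤ ‖z + η‖ := by
      refine le_trans ?_ (Complex.re_le_norm _)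
      simp; exact hz
    gcongr
  have hexp4 : Real.exp (l/(4*x)) = 4*M' := by
    rw [hl, mul_div_cancel_left₀ _ (by positivity), Real.exp_log (by positivity)]
  have key := PhragmenLindelof.right_half_plane_of_bounded_on_real
    (f := fun z => H z * cexp (l / (z + η))) (C := max (4*M'^2) (ε * Real.exp (l/η))) (z := (x:ℂ))
    ?_ ?_ ?_ ?_ (by simpa using hx.le)
  · have h1 : 8*M'^2 ≤ ‖H x * cexp (l / (x + η))‖ := by
      rw [norm_mul, Complex.norm_exp]
      have : ((l:ℂ) / (x + η)).re = l/(x+η) := by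
        rw [← Complex.ofReal_add, ← Complex.ofReal_div, Complex.ofReal_re]
      rw [this]
      have h2 : (4*M')^2 ≤ Real.exp (l/(x+η)) := by
        rw [← hexp4, ← Real.exp_nat_mul]
        apply Real.exp_le_exp.2
        have : ((2:ℕ):ℝ) * (l/(4*x)) = l/(2*x) := by push_cast; field_simp; ring
        rw [this]
        gcongr; linarith
      nlinarith [Real.exp_pos (l/(x+η))]
    have h2 := h1.trans key
    have h3 : ε * Real.exp (l/η) < 8*M'^2 := by
      calc ε * Real.exp (l/η) < 8 * M'^2 * Real.exp (-(l/η)) * Real.exp (l/η) := by gcongr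
        _ = 8*M'^2 := by rw [mul_assoc, ← Real.exp_add]; simp
    have h4 : max (4*M'^2) (ε * Real.exp (l/η)) < 8*M'^2 := max_lt (by nlinarith) h3
    linarith
  · have : closure {z : ℂ | 0 < z.re} = {z : ℂ | 0 ≤ z.re} := Complex.closure_setOfPred_lt_re 0
    apply DifferentiableOn.diffContOnCl
    rw [this]
    intro z hz
    apply DifferentiableAt.differentiableWithinAt
    have := hne z hz
    have hz2 := hH z
    fun_prop (disch := assumption)
  · refine ⟨1, by norm_num, 0, ?_⟩
    apply Asymptotics.IsBigO.of_bound (M * Real.exp (l/η))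
    filter_upwards [mem_inf_of_right (mem_principal_self _)] with z hz
    rw [norm_mul, Complex.norm_exp]
    simp only [zero_mul, Real.exp_zero, norm_one, mul_one]
    exact mul_le_mul (hHM z (le_of_lt hz)) (Real.exp_le_exp.2 (hre z (le_of_lt hz))) (Real.exp_pos _).le hM.le
  · refine ⟨M * Real.exp (l/η), ?_⟩
    rw [eventually_map]
    filter_upwards [eventually_ge_atTop 0] with u hu
    rw [norm_mul, Complex.norm_exp]
    exact mul_le_mul (hHM u (by simpa using hu)) (Real.exp_le_exp.2 (hre u (by simpa using hu))) (Real.exp_pos _).le hM.le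
  · intro y
    rw [norm_mul, Complex.norm_exp]
    by_cases hy : |y| ≤ r
    · exact le_max_of_le_right (mul_le_mul (hε y hy) (Real.exp_le_exp.2 (hre _ (by simp))) (Real.exp_pos _).le hε0)
    · apply le_max_of_le_left
      push Not at hy
      have hy2 : r^2 ≤ y^2 := by
        rw [← sq_abs y]; gcongr
      have h1 : ((l:ℂ) / (y * I + η)).re ≤ l / (4*x) := by
        have : ((l:ℂ) / (y * I + η)).re = l * (η / (η^2 + y^2)) := by
          rw [Complex.div_re]; simp [Complex.normSq_apply]; ring_nf
        rw [this, div_eq_mul_one_div l]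
        refine mul_le_mul_of_nonneg_left (le_trans ?_ hηr) hl0
        gcongr
        nlinarith
      calc ‖H (y*I)‖ * _ ≤ M' * Real.exp (l/(4*x)) :=
            mul_le_mul ((hHM _ (by simp)).trans (le_max_left _ _)) (Real.exp_le_exp.2 h1) (Real.exp_pos _).le (by positivity)
        _ = _ := by rw [hexp4]; ring

/-- averaged character -/
noncomputable def avgC (d : ℝ) (n : ℕ) : ℂ :=
  (1/d : ℝ) * ∫ u in (0:ℝ)..d, cexp (-(Real.log n * u) * I)

lemma avgC_one (d : ℝ) (hd : 0 < d) : avgC d 1 = 1 := by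
  have : (d:ℂ) ≠ 0 := by exact_mod_cast hd.ne'
  simp [avgC, this]

lemma norm_chi (a u : ℝ) : ‖cexp (-(a * u) * I)‖ = 1 := by
  have : (-((a:ℂ) * u) * I) = ((-(a*u) : ℝ) : ℂ) * I := by push_cast; ring
  rw [this, Complex.norm_exp_ofReal_mul_I]

lemma norm_avgC_le_one (d : ℝ) (hd : 0 < d) (n : ℕ) : ‖avgC d n‖ ≤ 1 := by
  rw [avgC, norm_mul, Complex.norm_real, Real.norm_of_nonneg (by positivity)]
  have : ‖∫ u in (0:ℝ)..d, cexp (-(Real.log n * u) * I)‖ ≤ 1 * |d - 0| :=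
    intervalIntegral.norm_integral_le_of_norm_le_const (fun u _ => (norm_chi _ _).le)
  rw [sub_zero, abs_of_pos hd, one_mul] at this
  calc _ ≤ 1/d * d := by gcongr
    _ = 1 := by field_simp

lemma norm_avgC_le (d : ℝ) (hd : 0 < d) (n : ℕ) (hn : 2 ≤ n) :
    ‖avgC d n‖ ≤ 2 / (d * Real.log n) := by
  have hl : 0 < Real.log n := Real.log_pos (by exact_mod_cast hn)
  have hc : (-(Real.log n : ℂ) * I) ≠ 0 := by
    simp only [ne_eq, mul_eq_zero, neg_eq_zero, I_ne_zero, or_false]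
    exact_mod_cast hl.ne'
  have h1 : ∫ u in (0:ℝ)..d, cexp (-(Real.log n * u) * I)
      = (cexp ((-(Real.log n : ℂ) * I) * d) - cexp ((-(Real.log n : ℂ) * I) * (0:ℝ))) / (-(Real.log n : ℂ) * I) := by
    rw [← integral_exp_mul_complex hc]
    congr 1; ext u; congr 1; ring
  rw [avgC, norm_mul, Complex.norm_real, Real.norm_of_nonneg (by positivity), h1, norm_div]
  have h2 : ‖-(Real.log n : ℂ) * I‖ = Real.log n := by
    rw [norm_mul, norm_neg, Complex.norm_real, Real.norm_of_nonneg hl.le]; simp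
  have h3 : ‖cexp ((-(Real.log n : ℂ) * I) * d) - cexp ((-(Real.log n : ℂ) * I) * (0:ℝ))‖ ≤ 2 := by
    refine (norm_sub_le _ _).trans ?_
    have : (-(Real.log n : ℂ) * I) * d = -(Real.log n * d) * I := by ring
    rw [this, norm_chi]
    simp; norm_num
  rw [h2]
  calc _ ≤ 1/d * (2 / Real.log n) := by gcongr
    _ = _ := by field_simp

/-- Averaging a trigonometric polynomial. -/
lemma avg_poly (s : Finset ℕ) (a : ℕ → ℂ) (d t : ℝ) :
    (1/d : ℝ) * ∫ u in (0:ℝ)..d, ∑ n ∈ s, a n * cexp (-(Real.log n * ((t + u : ℝ) : ℂ)) * I)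
      = ∑ n ∈ s, (a n * avgC d n) * cexp (-(Real.log n * t) * I) := by
  rw [intervalIntegral.integral_finsetSum]
  · rw [Finset.mul_sum]
    apply Finset.sum_congr rfl
    intro n _
    have : ∀ u : ℝ, a n * cexp (-(Real.log n * ((t + u : ℝ) : ℂ)) * I)
       = (a n * cexp (-(Real.log n * t) * I)) * cexp (-(Real.log n * u) * I) := by
      intro u
      rw [mul_assoc, ← Complex.exp_add]; push_cast; ring_nf
    simp_rw [this]
    rw [intervalIntegral.integral_const_mul, avgC]
    ring
  · intro n _
    apply Continuous.intervalIntegrable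
    fun_prop

lemma l1_avg (f : ℝ → ℂ) (hf : Continuous f) (d : ℝ) (hd : 0 < d) (T l : ℝ) (hl : 0 ≤ l) :
    ∫ t in T..(T+l), ‖(1/d : ℝ) * ∫ u in (0:ℝ)..d, f (t+u)‖ ≤ ∫ t in T..(T+(l+d)), ‖f t‖ := by
  have h1 : ∀ t : ℝ, ‖((1/d : ℝ):ℂ) * ∫ u in (0:ℝ)..d, f (t+u)‖ ≤ (1/d) * ∫ u in (0:ℝ)..d, ‖f (t+u)‖ := by
    intro t
    rw [norm_mul, Complex.norm_real, Real.norm_of_nonneg (by positivity)]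
    gcongr
    exact intervalIntegral.norm_integral_le_integral_norm hd.le
  have c1 : Continuous (fun t : ℝ => ∫ u in (0:ℝ)..d, f (t+u)) := by
    apply intervalIntegral.continuous_parametric_intervalIntegral_of_continuous'
    fun_prop
  have c2 : Continuous (fun t : ℝ => ∫ u in (0:ℝ)..d, ‖f (t+u)‖) := by
    apply intervalIntegral.continuous_parametric_intervalIntegral_of_continuous'
    fun_prop
  have c3 : Continuous (fun u : ℝ => ∫ t in T..(T+l), ‖f (t+u)‖) := by
    apply intervalIntegral.continuous_parametric_intervalIntegral_of_continuous'
    fun_prop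
  calc _ ≤ ∫ t in T..(T+l), (1/d) * ∫ u in (0:ℝ)..d, ‖f (t+u)‖ := by
        apply intervalIntegral.integral_mono_on (by linarith)
        · apply Continuous.intervalIntegrable; fun_prop
        · apply Continuous.intervalIntegrable; fun_prop
        · intro t _; exact h1 t
    _ = (1/d) * ∫ u in (0:ℝ)..d, ∫ t in T..(T+l), ‖f (t+u)‖ := by
        rw [intervalIntegral.integral_const_mul]
        congr 1
        apply intervalIntegral_intervalIntegral_swap
        have : Continuous (Function.uncurry fun t u : ℝ => ‖f (t+u)‖) := by fun_prop
        refine (this.continuousOn.integrableOn_compact ((isCompact_uIcc (a := T) (b := T+l)).prod (isCompact_uIcc (a := (0:ℝ)) (b := d))) (μ := volume)).mono_set ?_ 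
        exact Set.prod_mono Set.uIoc_subset_uIcc Set.uIoc_subset_uIcc
    _ ≤ (1/d) * ∫ u in (0:ℝ)..d, ∫ t in T..(T+(l+d)), ‖f t‖ := by
        gcongr
        apply intervalIntegral.integral_mono_on hd.le
        · exact c3.intervalIntegrable _ _
        · exact intervalIntegrable_const
        · intro u hu
          rw [intervalIntegral.integral_comp_add_right (fun t => ‖f t‖)]
          apply intervalIntegral.integral_mono_interval (by linarith [hu.1]) (by linarith) (by linarith [hu.2])
          · exact Eventually.of_forall fun _ => norm_nonneg _
          · exact hf.norm.intervalIntegrable _ _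
    _ = _ := by
        rw [intervalIntegral.integral_const]; simp; field_simp

/-- `g` is a multiplier realised by averaging over length at most `S`. -/
def IsMult (g : ℕ → ℂ) (S : ℝ) : Prop :=
  g 1 = 1 ∧ (∀ n, ‖g n‖ ≤ 1) ∧ ∀ (s : Finset ℕ) (a : ℕ → ℂ) (T l : ℝ), 0 ≤ l →
    ∫ t in T..(T+l), ‖∑ n ∈ s, (a n * g n) * cexp (-(Real.log n * t) * I)‖
      ≤ ∫ t in T..(T+(l+S)), ‖∑ n ∈ s, a n * cexp (-(Real.log n * t) * I)‖

lemma isMult_one : IsMult (fun _ => 1) 0 := by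
  refine ⟨rfl, by simp, ?_⟩
  intro s a T l hl
  simp

lemma IsMult.avg {g : ℕ → ℂ} {S : ℝ} (h : IsMult g S) (d : ℝ) (hd : 0 < d) :
    IsMult (fun n => g n * avgC d n) (S + d) := by
  refine ⟨by simp [h.1, avgC_one d hd], ?_, ?_⟩
  · intro n
    rw [norm_mul]
    exact mul_le_one₀ (h.2.1 n) (norm_nonneg _) (norm_avgC_le_one d hd n)
  · intro s a T l hl
    have h1 := l1_avg (fun t => ∑ n ∈ s, (a n * g n) * cexp (-(Real.log n * t) * I)) (by fun_prop) d hd T l hl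
    have h2 := h.2.2 s a T (l+d) (by linarith)
    simp only [avg_poly s (fun n => a n * g n)] at h1
    simp only [← mul_assoc]
    refine h1.trans (h2.trans (le_of_eq ?_))
    rw [show l + d + S = l + (S + d) by ring]

lemma IsMult.pow {g : ℕ → ℂ} {S : ℝ} (h : IsMult g S) (d : ℝ) (hd : 0 < d) (m : ℕ) :
    IsMult (fun n => g n * avgC d n ^ m) (S + m * d) := by
  induction m with
  | zero => simpa using h
  | succ m ih =>
    have := ih.avg d hd
    convert this using 1
    · ext n; ring
    · push_cast; ring

lemma isMult_prod (d : ℕ → ℝ) (hd : ∀ k, 0 < d k) (m : ℕ → ℕ) (K : ℕ) :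
    IsMult (fun n => ∏ k ∈ Finset.range K, avgC (d k) n ^ (m k)) (∑ k ∈ Finset.range K, m k * d k) := by
  induction K with
  | zero => simpa using isMult_one
  | succ K ih =>
    simp_rw [Finset.prod_range_succ, Finset.sum_range_succ]
    exact ih.pow _ (hd K) _

lemma IsMult.mono {g : ℕ → ℂ} {S S' : ℝ} (h : IsMult g S) (hS : 0 ≤ S) (hSS : S ≤ S') : IsMult g S' := by
  refine ⟨h.1, h.2.1, fun s a T l hl => (h.2.2 s a T l hl).trans ?_⟩
  apply intervalIntegral.integral_mono_interval le_rfl (by linarith) (by linarith)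
  · exact Eventually.of_forall fun _ => norm_nonneg _
  · apply Continuous.intervalIntegrable; fun_prop

lemma norm_prod_le_single (d : ℕ → ℝ) (hd : ∀ k, 0 < d k) (m : ℕ → ℕ) (K k n : ℕ) (hk : k < K) :
    ‖∏ k ∈ Finset.range K, avgC (d k) n ^ (m k)‖ ≤ ‖avgC (d k) n‖ ^ m k := by
  rw [norm_prod, ← Finset.mul_prod_erase _ _ (Finset.mem_range.2 hk), norm_pow]
  apply mul_le_of_le_one_right (by positivity)
  apply Finset.prod_le_one
  · intro i _; positivity
  · intro i _; rw [norm_pow]; exact pow_le_one₀ (norm_nonneg _) (norm_avgC_le_one _ (hd i) n)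

lemma summable_inv_mul_log_sq : Summable (fun n : ℕ => 4 / ((n:ℝ) * Real.log n ^ 2)) := by
  have h0 : ∀ n : ℕ, 0 ≤ 4 / ((n:ℝ) * Real.log n ^ 2) := fun n => by positivity
  rw [← summable_condensed_iff_of_eventually_nonneg (Eventually.of_forall h0)]
  · have : ∀ k : ℕ, (2:ℝ)^k * (4 / (((2^k : ℕ):ℝ) * Real.log ((2^k : ℕ):ℝ) ^ 2)) = (4 / Real.log 2 ^ 2) * (1 / (k:ℝ)^2) := by
      intro k
      push_cast
      rw [Real.log_pow]
      rcases Nat.eq_zero_or_pos k with rfl | hk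
      · simp
      · have : (0:ℝ) < k := by exact_mod_cast hk
        have : 0 < Real.log 2 := Real.log_pos (by norm_num)
        field_simp
    simp_rw [this]
    apply Summable.mul_left
    exact Real.summable_one_div_nat_pow.2 (by norm_num)
  · filter_upwards [eventually_ge_atTop 2] with n hn
    have h1 : 0 < Real.log n := Real.log_pos (by exact_mod_cast hn)
    have h2 : (0:ℝ) < n := by positivity
    have : Real.log n ≤ Real.log (n+1 : ℕ) := Real.log_le_log h2 (by push_cast; linarith)
    have : (n:ℝ) ≤ (n+1 : ℕ) := by push_cast; linarith
    gcongr

lemma summable_q (ω : ℝ → ℝ) (hmono : Monotone ω) (hle : ∀ t, ω t ≤ 1)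
    (hint : IntegrableOn (fun t : ℝ => (1 - ω t) / (t * Real.log t)) (Set.Ici 2)) :
    Summable (fun k : ℕ => 1 - ω (Real.exp (2^k))) := by
  set f := fun t : ℝ => (1 - ω t) / (t * Real.log t) with hf
  set a : ℕ → ℝ := fun k => Real.exp (2^k) with ha
  have hl2 : 0 < Real.log 2 := Real.log_pos (by norm_num)
  have ha2 : ∀ k, 2 ≤ a k := by
    intro k
    have h1 : (1:ℝ) ≤ 2^k := one_le_pow₀ (by norm_num)
    have := Real.add_one_le_exp ((2:ℝ)^k)
    simp only [ha]; linarith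
  have hmon : Monotone a := by
    intro i j hij
    apply Real.exp_le_exp.2
    exact pow_le_pow_right₀ (by norm_num) hij
  have hf0 : ∀ t ∈ Set.Ici (2:ℝ), 0 ≤ f t := by
    intro t ht
    have ht : 2 ≤ t := ht
    have : 0 < Real.log t := Real.log_pos (by linarith)
    have := hle t
    apply div_nonneg (by linarith) (by positivity)
  have hii : ∀ i j, IntervalIntegrable f volume (a i) (a j) := by
    intro i j
    apply IntegrableOn.intervalIntegrable
    apply hint.mono_set
    intro t ht
    exact (le_min (ha2 i) (ha2 j)).trans ht.1
  have step : ∀ k, Real.log 2 * (1 - ω (a (k+1))) ≤ ∫ t in (a k)..(a (k+1)), f t := by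
    intro k
    have h1 : ∫ t in (a k)..(a (k+1)), 1 / (t * Real.log t) = Real.log 2 := by
      have : ∫ t in (a k)..(a (k+1)), 1 / (t * Real.log t) = Real.log (Real.log (a (k+1))) - Real.log (Real.log (a k)) := by
        apply intervalIntegral.integral_eq_sub_of_hasDerivAt (f := fun t => Real.log (Real.log t))
        · intro t ht
          rw [Set.uIcc_of_le (hmon (Nat.le_succ k))] at ht
          have h2 : 2 ≤ t := (ha2 k).trans ht.1
          have h3 : 0 < Real.log t := Real.log_pos (by linarith)
          have h5 := (Real.hasDerivAt_log (by linarith : t ≠ 0)).log h3.ne'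
          have h6 : t⁻¹ / Real.log t = 1 / (t * Real.log t) := by field_simp
          rw [h6] at h5
          exact h5
        · apply ContinuousOn.intervalIntegrable
          intro t ht
          rw [Set.uIcc_of_le (hmon (Nat.le_succ k))] at ht
          have h2 : 2 ≤ t := (ha2 k).trans ht.1
          have h3 : 0 < Real.log t := Real.log_pos (by linarith)
          have h4 : t ≠ 0 := by linarith
          apply ContinuousAt.continuousWithinAt
          exact ContinuousAt.div continuousAt_const (continuousAt_id.mul (Real.continuousAt_log h4)) (by positivity)
      rw [this]
      simp only [ha, Real.log_exp]
      rw [Real.log_pow, Real.log_pow]; push_cast; ring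
    rw [← h1, mul_comm, ← intervalIntegral.integral_const_mul]
    apply intervalIntegral.integral_mono_on (hmon (Nat.le_succ k))
    · apply IntervalIntegrable.const_mul
      by_contra hc
      rw [intervalIntegral.integral_undef hc] at h1
      exact hl2.ne h1
    · exact hii _ _
    · intro t ht
      have h2 : 2 ≤ t := (ha2 k).trans ht.1
      have h3 : 0 < Real.log t := Real.log_pos (by linarith)
      have := hmono ht.2
      simp only [hf]
      rw [mul_one_div]
      gcongr
  have hs : Summable (fun k : ℕ => Real.log 2 * (1 - ω (a (k+1)))) := by
    apply summable_of_sum_range_le (c := ∫ t in Set.Ici 2, f t)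
    · intro k
      have := hle (a (k+1))
      apply mul_nonneg hl2.le (by linarith)
    · intro n
      calc _ ≤ ∑ k ∈ Finset.range n, ∫ t in (a k)..(a (k+1)), f t := Finset.sum_le_sum fun k _ => step k
        _ = ∫ t in (a 0)..(a n), f t := intervalIntegral.sum_integral_adjacent_intervals fun k _ => hii _ _
        _ = ∫ t in Set.Ioc (a 0) (a n), f t := intervalIntegral.integral_of_le (hmon (Nat.zero_le n))
        _ ≤ _ := by
          apply setIntegral_mono_set hint
          · exact (ae_restrict_iff' measurableSet_Ici).2 (Eventually.of_forall hf0)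
          · apply Eventually.of_forall
            intro t ht
            exact (ha2 0).trans ht.1.le
  have hs2 : Summable (fun k : ℕ => 1 - ω (a (k+1))) := (summable_mul_left_iff hl2.ne').1 hs
  exact (summable_nat_add_iff 1).1 hs2

lemma exists_mult (ω : ℝ → ℝ) (hmono : Monotone ω) (hle : ∀ t, ω t ≤ 1)
    (hq : Summable (fun k : ℕ => 1 - ω (Real.exp (2^k)))) (ρ : ℝ) (hρ : 0 < ρ) :
    ∃ B : ℕ → ℝ, Summable B ∧ (∀ n, 0 ≤ B n) ∧ ∀ (T σ : ℝ) (N : ℕ), 0 ≤ T → ω T ≤ σ →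
      (∀ n ∈ Finset.Ico 1 N, (n:ℝ) ≤ T^2) →
      ∃ g, IsMult g ρ ∧ ∀ n ∈ Finset.Ico 1 N, Real.exp (-(Real.log n * σ)) * ‖g n‖ ≤ B n := by
  set q : ℕ → ℝ := fun k => 1 - ω (Real.exp (2^k)) with hqdef
  have hq0 : ∀ k, 0 ≤ q k := fun k => by have := hle (Real.exp (2^k)); simp only [hqdef]; linarith
  set E := Real.exp 1 with hE
  have hE0 : 0 < E := Real.exp_pos 1
  set L : ℕ → ℝ := fun k => (2^(k+2) * q k + 1 + 2 * (k+1)) * (2 * E / 2^(k+1)) with hL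
  have hLs : Summable L := by
    have h1 : ∀ k, L k = 4 * E * q k + (2 * E * ((k:ℝ)^1 * (1/2)^k) + 3 * E * (1/2)^k) := by
      intro k
      simp only [hL, one_div, inv_pow]
      field_simp
      ring
    have h2 : L = fun k => 4 * E * q k + (2 * E * ((k:ℝ)^1 * (1/2)^k) + 3 * E * (1/2)^k) := funext h1
    rw [h2]
    apply (hq.mul_left _).add
    apply Summable.add
    · apply Summable.mul_left
      exact summable_pow_mul_geometric_of_norm_lt_one 1 (by norm_num)
    · apply Summable.mul_left
      exact summable_geometric_of_lt_one (by norm_num) (by norm_num)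
  have hL0 : ∀ k, 0 ≤ L k := fun k => by have := hq0 k; positivity
  obtain ⟨k1, hk1⟩ : ∃ k1, ∑' j, L (j + k1) < ρ := by
    have := (tendsto_sum_nat_add L).eventually (gt_mem_nhds hρ)
    exact this.exists
  set d : ℕ → ℝ := fun j => 2 * E / 2^(j+k1+1) with hd
  have hd0 : ∀ j, 0 < d j := fun j => by positivity
  set m : ℕ → ℕ := fun j => ⌈(2:ℝ)^(j+k1+2) * q (j+k1)⌉₊ + 2 * (j+k1+1) with hm
  set D : ℝ := Real.exp (|ω 0| * 2^(k1+1)) with hD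
  set n0 : ℕ := ⌈Real.exp (2^(k1+1))⌉₊ with hn0
  refine ⟨fun n => (if n < n0 then D else 0) + 4 / ((n:ℝ) * Real.log n ^ 2), ?_, ?_, ?_⟩
  · apply Summable.add _ summable_inv_mul_log_sq
    apply summable_of_ne_finset_zero (s := Finset.range n0)
    intro n hn
    simp only [Finset.mem_range] at hn
    simp [hn]
  · intro n
    have : 0 ≤ if n < n0 then D else 0 := by split_ifs <;> positivity
    positivity
  intro T σ N hT hσ hN
  refine ⟨fun n => ∏ k ∈ Finset.range N, avgC (d k) n ^ (m k), ?_, ?_⟩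
  · apply (isMult_prod d hd0 m N).mono
    · exact Finset.sum_nonneg fun k _ => by have := hd0 k; positivity
    · calc _ ≤ ∑ k ∈ Finset.range N, L (k + k1) := by
            apply Finset.sum_le_sum
            intro k _
            have h1 : (m k : ℝ) ≤ 2^(k+k1+2) * q (k+k1) + 1 + 2 * ((k+k1 : ℕ)+1) := by
              simp only [hm]
              push_cast
              have := Nat.ceil_lt_add_one (a := (2:ℝ)^(k+k1+2) * q (k+k1)) (by have := hq0 (k+k1); positivity)
              linarith
            exact mul_le_mul_of_nonneg_right h1 (hd0 k).le
        _ ≤ ∑' j, L (j + k1) := by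
            apply Summable.sum_le_tsum
            · intro i _; exact hL0 _
            · exact (summable_nat_add_iff k1).2 hLs
        _ ≤ ρ := hk1.le
  · intro n hn
    have hnT := hN n hn
    obtain ⟨hn1, hnN⟩ := Finset.mem_Ico.1 hn
    have hn1' : (1:ℝ) ≤ n := by exact_mod_cast hn1
    have hlog0 : 0 ≤ Real.log n := Real.log_nonneg hn1'
    by_cases hs : Real.log n < 2^(k1+1)
    · have h1 : n < n0 := by
        rw [hn0, Nat.lt_ceil]
        rwa [Real.log_lt_iff_lt_exp (by linarith)] at hs
      have h2 : ‖∏ k ∈ Finset.range N, avgC (d k) n ^ (m k)‖ ≤ 1 := (isMult_prod d hd0 m N).2.1 n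
      simp only [h1, if_true]
      have h3 : Real.exp (-(Real.log n * σ)) ≤ D := by
        apply Real.exp_le_exp.2
        have h4 : -σ ≤ |ω 0| := by
          have := hmono hT
          have := neg_abs_le (ω 0)
          linarith
        calc -(Real.log n * σ) = Real.log n * (-σ) := by ring
          _ ≤ Real.log n * |ω 0| := by gcongr
          _ ≤ 2^(k1+1) * |ω 0| := by gcongr
          _ = _ := by ring
      have h5 : 0 ≤ 4 / ((n:ℝ) * Real.log n ^ 2) := by positivity
      calc _ ≤ D * 1 := mul_le_mul h3 h2 (norm_nonneg _) (Real.exp_pos _).le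
        _ ≤ _ := by linarith
    · push Not at hs
      have hp : ∀ k : ℕ, (1:ℝ) ≤ 2^k := fun k => one_le_pow₀ (by norm_num)
      obtain ⟨k, hk, hk'⟩ := exists_nat_pow_near ((hp (k1+1)).trans hs) (by norm_num : (1:ℝ) < 2)
      have hkk : k1 + 1 < k + 1 := by
        have : (2:ℝ)^(k1+1) < 2^(k+1) := hs.trans_lt hk'
        exact (pow_lt_pow_iff_right₀ (by norm_num)).1 this
      obtain ⟨j, rfl⟩ : ∃ j, k = j + k1 + 1 := ⟨k - k1 - 1, by omega⟩
      have hlogpos : 0 < Real.log n := lt_of_lt_of_le (by positivity) hs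
      have hn2 : 2 ≤ n := by
        by_contra hc
        have : n = 1 := by omega
        rw [this] at hlogpos
        simp at hlogpos
      have hjN : j < N := by
        have h1 : Real.log n < n := by linarith [Real.log_le_sub_one_of_pos (by linarith : (0:ℝ) < n)]
        have h2 : ((2^(j+k1+1) : ℕ) : ℝ) < n := by push_cast; linarith
        have h3 : 2^(j+k1+1) < n := by exact_mod_cast h2
        have := Nat.lt_two_pow_self (n := j+k1+1)
        omega
      have h1 := norm_prod_le_single d hd0 m N j n hjN
      have h2 : ‖avgC (d j) n‖ ≤ Real.exp (-1) := by
        refine (norm_avgC_le _ (hd0 j) n hn2).trans ?_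
        rw [Real.exp_neg, ← hE, div_le_iff₀ (mul_pos (hd0 j) hlogpos)]
        simp only [hd]
        rw [show E⁻¹ * (2 * E / 2^(j+k1+1) * Real.log n) = 2 * (Real.log n / 2^(j+k1+1)) by field_simp]
        have : 1 ≤ Real.log n / 2^(j+k1+1) := by rwa [one_le_div (by positivity)]
        linarith
      have h3 : ‖avgC (d j) n‖ ^ m j ≤ Real.exp (-(2^(j+k1+2) * q (j+k1)) - 2 * (j+k1+1)) := by
        calc _ ≤ Real.exp (-1) ^ m j := by gcongr
          _ = Real.exp (-(m j)) := by rw [← Real.exp_nat_mul]; simp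
          _ ≤ _ := by
            apply Real.exp_le_exp.2
            simp only [hm]
            push_cast
            have := Nat.le_ceil ((2:ℝ)^(j+k1+2) * q (j+k1))
            linarith
      have h4 : Real.exp (2^(j+k1)) ≤ T := by
        apply (sq_le_sq₀ (Real.exp_pos _).le hT).1
        refine le_trans ?_ hnT
        rw [← Real.exp_nat_mul, ← Real.le_log_iff_exp_le (by linarith)]
        refine le_trans (le_of_eq ?_) hk
        push_cast; ring
      have h5 : 1 - σ ≤ q (j+k1) := by
        have := hmono h4
        simp only [hqdef]; linarith
      have h6 : -(Real.log n * σ) ≤ - Real.log n + 2^(j+k1+2) * q (j+k1) := by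
        have : Real.log n * (1-σ) ≤ 2^(j+k1+1+1) * q (j+k1) := by
          calc _ ≤ Real.log n * q (j+k1) := by gcongr
            _ ≤ _ := mul_le_mul_of_nonneg_right hk'.le (hq0 _)
        linarith
      have h7 : Real.exp (-(Real.log n * σ)) * ‖∏ k ∈ Finset.range N, avgC (d k) n ^ (m k)‖
          ≤ Real.exp (- Real.log n) * Real.exp (- 2 * (j+k1+1)) := by
        calc _ ≤ Real.exp (- Real.log n + 2^(j+k1+2) * q (j+k1)) * Real.exp (-(2^(j+k1+2) * q (j+k1)) - 2 * (j+k1+1)) :=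
              mul_le_mul (Real.exp_le_exp.2 h6) (h1.trans h3) (norm_nonneg _) (Real.exp_pos _).le
          _ = _ := by rw [← Real.exp_add, ← Real.exp_add]; ring_nf
      have h8 : Real.log n ≤ 2 * Real.exp (j+k1+1) := by
        have : (2:ℝ)^(j+k1+1) ≤ Real.exp (j+k1+1) := by
          have : Real.exp (j+k1+1) = Real.exp 1 ^ (j+k1+1) := by
            rw [← Real.exp_nat_mul]; push_cast; simp
          rw [this]
          gcongr
          have := Real.add_one_le_exp 1
          linarith
        rw [pow_succ] at hk'
        linarith
      have h9 : Real.exp (- 2 * (j+k1+1)) ≤ 4 / Real.log n ^ 2 := by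
        rw [le_div_iff₀ (by positivity)]
        have : Real.exp (- 2 * (j+k1+1)) * (2 * Real.exp (j+k1+1))^2 = 4 := by
          rw [mul_pow, ← Real.exp_nat_mul, mul_left_comm, ← Real.exp_add]
          push_cast; ring_nf; simp
        calc _ ≤ Real.exp (- 2 * (j+k1+1)) * (2 * Real.exp (j+k1+1))^2 := by gcongr
          _ = 4 := this
      have h10 : 0 ≤ if n < n0 then D else 0 := by split_ifs <;> positivity
      have h11 : Real.exp (- Real.log n) = 1 / n := by
        rw [Real.exp_neg, Real.exp_log (by linarith), one_div]
      calc _ ≤ _ := h7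
        _ ≤ 1/n * (4 / Real.log n ^ 2) := by rw [h11]; gcongr
        _ = 4 / ((n:ℝ) * Real.log n ^ 2) := by field_simp
        _ ≤ _ := by linarith

lemma dirichlet_lower (ω : ℝ → ℝ) (hmono : Monotone ω) (hle : ∀ t, ω t ≤ 1)
    (hq : Summable (fun k : ℕ => 1 - ω (Real.exp (2^k)))) (δ : ℝ) (hδ : 0 < δ) :
    ∃ C > (0:ℝ), ∀ (T σ : ℝ) (N : ℕ), 0 ≤ T → ω T ≤ σ → 2 ≤ N →
      (∀ n ∈ Finset.Ico 1 N, (n:ℝ) ≤ T^2) →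
      C ≤ ∫ t in T..(T+δ), ‖∑ n ∈ Finset.Ico 1 N, ((Real.exp (-(Real.log n * σ)) : ℝ) : ℂ) * cexp (-(Real.log n * t) * I)‖ := by
  obtain ⟨B, hBs, hB0, hB⟩ := exists_mult ω hmono hle hq (δ/4) (by positivity)
  set M : ℝ := (∑' n, B n) + 1 with hM
  have hM1 : 1 ≤ M := by
    have : 0 ≤ ∑' n, B n := tsum_nonneg hB0
    linarith
  obtain ⟨p, hp⟩ : ∃ p : ℕ, M * (1/2)^(p+1) ≤ 1/2 := by
    have h := tendsto_pow_atTop_nhds_zero_of_lt_one (r := (1/2:ℝ)) (by norm_num) (by norm_num)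
    obtain ⟨p, hp⟩ := (h.eventually (gt_mem_nhds (show (0:ℝ) < 1/M by positivity))).exists
    refine ⟨p, ?_⟩
    rw [lt_div_iff₀ (by positivity)] at hp
    rw [pow_succ]; linarith
  obtain ⟨c, hc0, hc⟩ := two_const M (p+1) (δ/4) (by linarith) (by positivity) (by positivity)
  refine ⟨c * (δ/4), by positivity, ?_⟩
  intro T σ N hT hσ hN2 hN
  obtain ⟨g, hg, hgB⟩ := hB T σ N hT hσ hN
  set a : ℕ → ℂ := fun n => ((Real.exp (-(Real.log n * σ)) : ℝ) : ℂ) with ha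
  set s := Finset.Ico 1 N with hs
  set Int := ∫ t in T..(T+δ), ‖∑ n ∈ s, a n * cexp (-(Real.log n * t) * I)‖ with hInt
  have hd : 0 < δ/4 := by positivity
  set b : ℕ → ℂ := fun n => a n * g n * avgC (δ/4) n with hb
  have hbB : ∀ n ∈ s, ‖b n‖ ≤ B n := by
    intro n hn
    simp only [hb, ha]
    rw [norm_mul, norm_mul, Complex.norm_real, Real.norm_of_nonneg (Real.exp_pos _).le]
    refine (mul_le_of_le_one_right (by positivity) (norm_avgC_le_one _ hd n)).trans (hgB n hn)
  have hb1 : b 1 = 1 := by simp [hb, ha, hg.1, avgC_one _ hd]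
  have hsumB : ∀ s' ⊆ s, ∑ n ∈ s', ‖b n‖ ≤ M := by
    intro s' hs'
    calc _ ≤ ∑ n ∈ s', B n := Finset.sum_le_sum fun n hn => hbB n (hs' hn)
      _ ≤ ∑' n, B n := hBs.sum_le_tsum _ fun n _ => hB0 n
      _ ≤ M := by linarith
  set t0 := T + δ/4 with ht0
  set H : ℂ → ℂ := fun z => ∑ n ∈ s, b n * cexp (-(Real.log n * t0) * I) * cexp (-(Real.log n * z)) with hH
  have hlog : ∀ n ∈ s, 0 ≤ Real.log n := fun n hn =>
    Real.log_nonneg (by exact_mod_cast (Finset.mem_Ico.1 hn).1)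
  have key := hc H (by simp only [hH]; fun_prop) ?_ ?_ (Int / (δ/4)) ?_
  · rwa [le_div_iff₀ hd] at key
  · intro z hz
    refine (norm_sum_le _ _).trans (le_trans (Finset.sum_le_sum ?_) (hsumB s (Finset.Subset.refl _)))
    intro n hn
    rw [norm_mul, norm_mul, norm_chi, mul_one]
    apply mul_le_of_le_one_right (norm_nonneg _)
    rw [Complex.norm_exp]
    apply Real.exp_le_one_iff.2
    have := hlog n hn
    simp only [neg_re, mul_re, ofReal_re, ofReal_im, zero_mul, sub_zero]
    have := mul_nonneg this hz
    linarith
  · have h1s : 1 ∈ s := Finset.mem_Ico.2 ⟨le_rfl, hN2⟩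
    have e1 : H ((p+1 : ℝ) : ℂ) = 1 + ∑ n ∈ s.erase 1, b n * cexp (-(Real.log n * t0) * I) * cexp (-(Real.log n * ((p+1:ℝ):ℂ))) := by
      simp only [hH]
      rw [← Finset.add_sum_erase _ _ h1s]
      simp [hb1]
    have e2 : ‖∑ n ∈ s.erase 1, b n * cexp (-(Real.log n * t0) * I) * cexp (-(Real.log n * ((p+1:ℝ):ℂ)))‖ ≤ 1/2 := by
      refine le_trans ?_ hp
      refine (norm_sum_le _ _).trans ?_
      calc _ ≤ ∑ n ∈ s.erase 1, ‖b n‖ * (1/2)^(p+1) := by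
            apply Finset.sum_le_sum
            intro n hn
            rw [norm_mul, norm_mul, norm_chi, mul_one]
            gcongr
            rw [Complex.norm_exp]
            have hn1 : n ≠ 1 := (Finset.mem_erase.1 hn).1
            have hn2 : 1 ≤ n := (Finset.mem_Ico.1 (Finset.mem_erase.1 hn).2).1
            have hn3 : (2:ℝ) ≤ n := by exact_mod_cast (by omega : 2 ≤ n)
            have : (-((Real.log n : ℂ) * ((p+1:ℝ):ℂ))).re = (p+1 : ℕ) * (-Real.log n) := by
              rw [← Complex.ofReal_mul, ← Complex.ofReal_neg, Complex.ofReal_re]; push_cast; ring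
            rw [this, Real.exp_nat_mul, Real.exp_neg, Real.exp_log (by linarith)]
            gcongr
            rw [one_div]
            gcongr
        _ = (∑ n ∈ s.erase 1, ‖b n‖) * (1/2)^(p+1) := by rw [Finset.sum_mul]
        _ ≤ _ := by
          gcongr
          exact hsumB _ (Finset.erase_subset _ _)
    have e3 := norm_sub_le (H ((p+1 : ℝ) : ℂ)) (∑ n ∈ s.erase 1, b n * cexp (-(Real.log n * t0) * I) * cexp (-(Real.log n * ((p+1:ℝ):ℂ))))
    rw [e1, add_sub_cancel_right, norm_one, ← e1] at e3
    linarith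
  · intro y hy
    rw [abs_le] at hy
    have f1 : H (y * I) = ((1/(δ/4) : ℝ) : ℂ) * ∫ u in (0:ℝ)..(δ/4), ∑ n ∈ s, (a n * g n) * cexp (-(Real.log n * ((t0 + y + u : ℝ) : ℂ)) * I) := by
      rw [avg_poly s (fun n => a n * g n)]
      simp only [hH]
      apply Finset.sum_congr rfl
      intro n _
      rw [mul_assoc, ← Complex.exp_add]
      congr 2
      push_cast; ring
    rw [f1, norm_mul, Complex.norm_real, Real.norm_of_nonneg (by positivity), one_div, inv_mul_eq_div]
    gcongr
    have f2 := intervalIntegral.norm_integral_le_integral_norm (μ := volume) (f := fun u : ℝ => ∑ n ∈ s, (a n * g n) * cexp (-(Real.log n * ((t0 + y + u : ℝ) : ℂ)) * I)) hd.le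
    refine f2.trans ?_
    have f3 := intervalIntegral.integral_comp_add_left (a := 0) (b := δ/4) (fun u : ℝ => ‖∑ n ∈ s, (a n * g n) * cexp (-(Real.log n * ((u : ℝ) : ℂ)) * I)‖) (t0 + y)
    rw [f3]
    have f4 := hg.2.2 s a T (3*δ/4) (by positivity)
    rw [show 3*δ/4 + δ/4 = δ by ring] at f4
    refine le_trans ?_ f4
    apply intervalIntegral.integral_mono_interval (by linarith) (by linarith) (by linarith)
    · exact Eventually.of_forall fun _ => norm_nonneg _
    · apply Continuous.intervalIntegrable; fun_prop

/-- Euler–Maclaurin difference term. -/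
noncomputable def emTerm (n : ℕ) (s : ℂ) : ℂ :=
  ((n:ℂ)+1) ^ (-s) - (((n:ℂ)+1+1) ^ (1-s) - ((n:ℂ)+1) ^ (1-s)) / (1-s)

lemma emTerm_bound (n : ℕ) (s : ℂ) (hs : 0 < s.re) (h1 : s ≠ 1) :
    ‖emTerm n s‖ ≤ ‖s‖ * ((n:ℝ)+1) ^ (-s.re - 1) := by
  have h1' : 1 - s ≠ 0 := sub_ne_zero.2 h1.symm
  have hs0 : s ≠ 0 := by rintro rfl; simp at hs
  set a : ℝ := (n:ℝ)+1 with ha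
  have ha0 : 0 < a := by positivity
  -- first mean value estimate
  have A : ∀ x ∈ Set.Icc a (a+1), ‖(x:ℂ)^(-s) - (a:ℂ)^(-s)‖ ≤ ‖s‖ * a ^ (-s.re-1) := by
    intro x hx
    have := Convex.norm_image_sub_le_of_norm_hasDerivWithin_le (f := fun y : ℝ => (y:ℂ)^(-s))
      (f' := fun y : ℝ => (-s) * (y:ℂ)^(-s-1)) (s := Set.Icc a (a+1)) (C := ‖s‖ * a ^ (-s.re-1)) (x := a) (y := x)
      ?_ ?_ (convex_Icc _ _) ⟨le_rfl, by linarith⟩ hx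
    · refine this.trans ?_
      have h2 : ‖x - a‖ ≤ 1 := by
        rw [Real.norm_of_nonneg (by linarith [hx.1])]; linarith [hx.2]
      exact mul_le_of_le_one_right (by positivity) h2
    · intro y hy
      have hy0 : y ≠ 0 := by linarith [hy.1]
      exact (hasDerivAt_ofReal_cpow_const hy0 (by simpa using hs0) |>.hasDerivWithinAt)
    · intro y hy
      have hy0 : 0 < y := by linarith [hy.1]
      rw [norm_mul, norm_neg, Complex.norm_cpow_eq_rpow_re_of_pos hy0]
      gcongr
      simp only [sub_re, neg_re, one_re]
      exact Real.rpow_le_rpow_of_nonpos ha0 hy.1 (by linarith)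
  have B := Convex.norm_image_sub_le_of_norm_hasDerivWithin_le (f := fun y : ℝ => (y:ℂ)^(1-s) / (1-s) - y * (a:ℂ)^(-s))
      (f' := fun y : ℝ => (y:ℂ)^(-s) - (a:ℂ)^(-s)) (s := Set.Icc a (a+1)) (C := ‖s‖ * a ^ (-s.re-1)) (x := a) (y := a+1)
      ?_ A (convex_Icc _ _) ⟨le_rfl, by linarith⟩ ⟨by linarith, le_rfl⟩
  · have e : ‖a + 1 - a‖ = 1 := by simp
    rw [e, mul_one] at B
    refine le_trans (le_of_eq ?_) B
    rw [← norm_neg, emTerm]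
    congr 1
    simp only [ha]; push_cast
    ring
  · intro y hy
    have hy0 : y ≠ 0 := by linarith [hy.1]
    apply HasDerivAt.hasDerivWithinAt
    apply HasDerivAt.sub
    · have := (hasDerivAt_ofReal_cpow_const hy0 h1').div_const (1-s)
      have h5 : (1 - s) * (y:ℂ) ^ (1 - s - 1) / (1 - s) = (y:ℂ) ^ (-s) := by
        rw [mul_div_cancel_left₀ _ h1']
        congr 1; ring
      rw [h5] at this
      exact this
    · simpa using (Complex.ofRealCLM.hasDerivAt (x := y)).mul_const ((a:ℂ)^(-s))

lemma emTerm_sum (N : ℕ) (s : ℂ) :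
    ∑ n ∈ Finset.range N, emTerm n s
      = ∑ n ∈ Finset.range N, ((n:ℂ)+1) ^ (-s) - (((N:ℂ)+1)^(1-s) - 1) / (1-s) := by
  induction N with
  | zero => simp
  | succ N ih =>
    rw [Finset.sum_range_succ, Finset.sum_range_succ, ih, emTerm]
    push_cast; ring

lemma summable_em (c : ℝ) (hc : 0 < c) : Summable (fun n : ℕ => ((n:ℝ)+1) ^ (-c - 1)) := by
  have := (summable_nat_add_iff 1).2 (Real.summable_nat_rpow.2 (by linarith : -c - 1 < -1))
  simpa using this

lemma zeta_eq_em (s : ℂ) (hs : 0 < s.re) (hi : 0 < s.im) :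
    riemannZeta s = 1 / (s-1) + ∑' n, emTerm n s := by
  set U : Set ℂ := {z | 0 < z.re} ∩ {z | 0 < z.im} with hU
  have hUo : IsOpen U := (isOpen_lt continuous_const Complex.continuous_re).inter (isOpen_lt continuous_const Complex.continuous_im)
  have hUc : IsPreconnected U := ((convex_halfSpace_re_gt 0).inter (convex_halfSpace_im_gt 0)).isPreconnected
  have hne : ∀ z ∈ U, z ≠ 1 := by
    rintro z ⟨_, hz⟩ rfl
    simp at hz
  have hterm : ∀ n, DifferentiableOn ℂ (emTerm n) U := by
    intro n z hz
    have h1 : (1:ℂ) - z ≠ 0 := sub_ne_zero.2 (hne z hz).symm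
    have h2 : (n:ℂ) + 1 ≠ 0 := by exact_mod_cast Nat.succ_ne_zero n
    have h3 : (n:ℂ) + 1 + 1 ≠ 0 := by exact_mod_cast Nat.succ_ne_zero (n+1)
    apply DifferentiableAt.differentiableWithinAt
    unfold emTerm
    have d1 : DifferentiableAt ℂ (fun z : ℂ => -z) z := by fun_prop
    have d2 : DifferentiableAt ℂ (fun z : ℂ => 1-z) z := by fun_prop
    exact (d1.const_cpow (Or.inl h2)).sub (((d2.const_cpow (Or.inl h3)).sub (d2.const_cpow (Or.inl h2))).div d2 h1)
  have hdiff : DifferentiableOn ℂ (fun z => ∑' n, emTerm n z) U := by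
    intro z hz
    set V : Set ℂ := U ∩ ({w | z.re/2 < w.re} ∩ Metric.ball 0 (‖z‖+1)) with hV
    have hVo : IsOpen V := hUo.inter ((isOpen_lt continuous_const Complex.continuous_re).inter Metric.isOpen_ball)
    have hzV : z ∈ V := ⟨hz, by have := hz.1; simp at this ⊢; linarith, by simp⟩
    have : DifferentiableOn ℂ (fun z => ∑' n, emTerm n z) V := by
      apply Complex.differentiableOn_tsum_of_summable_norm (u := fun n : ℕ => (‖z‖+1) * ((n:ℝ)+1)^(-(z.re/2) - 1))
      · apply Summable.mul_left
        exact summable_em _ (by have := hz.1; simp at this; linarith)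
      · intro n; exact (hterm n).mono Set.inter_subset_left
      · exact hVo
      · intro n w hw
        refine (emTerm_bound n w hw.1.1 (hne w hw.1)).trans ?_
        have h1 : ‖w‖ ≤ ‖z‖ + 1 := by
          have := hw.2.2; rw [mem_ball_zero_iff] at this; exact this.le
        have h2 : z.re/2 < w.re := hw.2.1
        gcongr
        linarith
    exact (this.differentiableAt (hVo.mem_nhds hzV)).differentiableWithinAt
  have hdz : DifferentiableOn ℂ riemannZeta U := fun z hz =>
    (differentiableAt_riemannZeta (hne z hz)).differentiableWithinAt
  have hdr : DifferentiableOn ℂ (fun z => 1 / (z-1) + ∑' n, emTerm n z) U := by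
    apply DifferentiableOn.add _ hdiff
    intro z hz
    have : z - 1 ≠ 0 := sub_ne_zero.2 (hne z hz)
    apply DifferentiableAt.differentiableWithinAt
    fun_prop (disch := assumption)
  have hbig : ∀ z ∈ U, 1 < z.re → riemannZeta z = 1/(z-1) + ∑' n, emTerm n z := by
    intro z hz hz1
    have hs1 : Summable (fun n => emTerm n z) := by
      apply Summable.of_norm_bounded (g := fun n : ℕ => ‖z‖ * ((n:ℝ)+1)^(-z.re-1))
      · exact (summable_em _ hz.1).mul_left _
      · intro n; exact emTerm_bound n z hz.1 (hne z hz)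
    have t1 := hs1.hasSum.tendsto_sum_nat
    have t2 : Tendsto (fun N => ∑ n ∈ Finset.range N, ((n:ℂ)+1) ^ (-z)) atTop (nhds (riemannZeta z)) := by
      rw [zeta_eq_tsum_one_div_nat_add_one_cpow hz1]
      have hs2 : Summable (fun n : ℕ => 1 / ((n:ℂ)+1)^z) := by
        have := (summable_nat_add_iff 1).2 (Complex.summable_one_div_nat_cpow.2 hz1)
        simpa using this
      have := hs2.hasSum.tendsto_sum_nat
      simp_rw [Complex.cpow_neg]
      simpa [one_div] using this
    have t3 : Tendsto (fun N : ℕ => (((N:ℂ)+1)^(1-z) - 1) / (1-z)) atTop (nhds ((0 - 1)/(1-z))) := by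
      apply Tendsto.div_const
      apply Tendsto.sub_const
      rw [tendsto_zero_iff_norm_tendsto_zero]
      have : ∀ N : ℕ, ‖((N:ℂ)+1)^(1-z)‖ = (((N+1:ℕ):ℝ)) ^ (-(z.re-1)) := by
        intro N
        rw [show ((N:ℂ)+1) = (((N+1:ℕ):ℝ):ℂ) by push_cast; rfl, Complex.norm_cpow_eq_rpow_re_of_pos (by positivity)]
        congr 1; simp
      simp_rw [this]
      have := (tendsto_rpow_neg_atTop (by linarith : 0 < z.re - 1)).comp tendsto_natCast_atTop_atTop
      exact (tendsto_add_atTop_iff_nat 1).2 this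
    have t4 := t2.sub t3
    simp_rw [← emTerm_sum _ z] at t4
    have := tendsto_nhds_unique t1 t4
    rw [this]
    have h1 : (1:ℂ) - z ≠ 0 := sub_ne_zero.2 (hne z hz).symm
    have h2 : z - 1 ≠ 0 := sub_ne_zero.2 (hne z hz)
    field_simp
    ring
  have hmem : (2 + I : ℂ) ∈ U := by constructor <;> simp
  have := (hdz.analyticOnNhd hUo).eqOn_of_preconnected_of_eventuallyEq (hdr.analyticOnNhd hUo) hUc hmem ?_
  · exact this ⟨hs, hi⟩
  · have h1 : {z : ℂ | 1 < z.re} ∈ nhds (2 + I : ℂ) := (isOpen_lt continuous_const Complex.continuous_re).mem_nhds (by simp)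
    filter_upwards [h1, hUo.mem_nhds hmem] with z hz hzU
    exact hbig z hzU hz

lemma zeta_approx (s : ℂ) (hs : 3/4 ≤ s.re) (hi : 1 ≤ s.im) (N : ℕ) :
    ‖riemannZeta s - ∑ n ∈ Finset.range N, ((n:ℂ)+1) ^ (-s)‖
      ≤ ((N:ℝ)+1)^(1-s.re) / s.im + ‖s‖ * (((N:ℝ)+1)^(-(3/5:ℝ)) * ∑' n : ℕ, ((n:ℝ)+1)^(-(3/20:ℝ)-1)) := by
  have hne : s ≠ 1 := by rintro rfl; simp at hi; linarith
  have hs0 : 0 < s.re := by linarith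
  have hs1 : Summable (fun n => emTerm n s) := by
    apply Summable.of_norm_bounded (g := fun n : ℕ => ‖s‖ * ((n:ℝ)+1)^(-s.re-1))
    · exact (summable_em _ hs0).mul_left _
    · intro n; exact emTerm_bound n s hs0 hne
  have e1 := zeta_eq_em s hs0 (by linarith)
  rw [← hs1.sum_add_tsum_nat_add N, emTerm_sum N s] at e1
  have h1 : (1:ℂ) - s ≠ 0 := sub_ne_zero.2 hne.symm
  have h2 : s - 1 ≠ 0 := sub_ne_zero.2 hne
  have e2 : riemannZeta s - ∑ n ∈ Finset.range N, ((n:ℂ)+1) ^ (-s) = ((N:ℂ)+1)^(1-s) / (s-1) + ∑' n, emTerm (n+N) s := by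
    rw [e1]
    field_simp
    ring
  rw [e2]
  refine (norm_add_le _ _).trans (add_le_add ?_ ?_)
  · rw [norm_div, show ((N:ℂ)+1) = (((N+1:ℕ):ℝ):ℂ) by push_cast; rfl, Complex.norm_cpow_eq_rpow_re_of_pos (by positivity)]
    have : s.im ≤ ‖s-1‖ := by
      have := Complex.im_le_norm (s-1)
      simpa using this
    simp only [sub_re, one_re]
    push_cast
    gcongr
  · have hS := summable_em (3/20) (by norm_num)
    rw [← tsum_mul_left, ← tsum_mul_left]
    have hb : ∀ n : ℕ, ‖emTerm (n+N) s‖ ≤ ‖s‖ * (((N:ℝ)+1)^(-(3/5:ℝ)) * ((n:ℝ)+1)^(-(3/20:ℝ)-1)) := by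
      intro n
      refine (emTerm_bound (n+N) s hs0 hne).trans ?_
      gcongr
      push_cast
      calc ((n:ℝ)+N+1)^(-s.re-1) ≤ ((n:ℝ)+N+1)^(-(3/5:ℝ) + (-(3/20:ℝ)-1)) := by
            apply Real.rpow_le_rpow_of_exponent_le
            · have : (0:ℝ) ≤ n := by positivity
              have : (0:ℝ) ≤ N := by positivity
              linarith
            · linarith
        _ = ((n:ℝ)+N+1)^(-(3/5:ℝ)) * ((n:ℝ)+N+1)^(-(3/20:ℝ)-1) := Real.rpow_add (by positivity) _ _
        _ ≤ _ := by
          gcongr ?_ * ?_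
          · apply Real.rpow_le_rpow_of_nonpos (by positivity) _ (by norm_num)
            have : (0:ℝ) ≤ n := by positivity
            linarith
          · apply Real.rpow_le_rpow_of_nonpos (by positivity) _ (by norm_num)
            have : (0:ℝ) ≤ N := by positivity
            linarith
    exact tsum_of_norm_bounded ((hS.mul_left _).mul_left _).hasSum hb

lemma zeta_cont_shift : Continuous (fun p : (ℝ × ℝ) × ℝ =>
    ‖riemannZeta ((p.1.2 : ℂ) + ((max p.1.1 2 + max p.2 0 : ℝ) : ℂ) * I)‖) := by
  apply Continuous.norm
  rw [continuous_iff_continuousAt]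
  intro p
  have hne : ((p.1.2 : ℂ) + ((max p.1.1 2 + max p.2 0 : ℝ) : ℂ) * I) ≠ 1 := by
    intro h
    have := congrArg Complex.im h
    simp only [add_im, ofReal_im, mul_im, ofReal_re, I_im, mul_one, I_re, mul_zero, add_zero, zero_add, one_im] at this
    have h1 := le_max_right p.1.1 2
    have h2 := le_max_right p.2 0
    linarith
  have hc : Continuous (fun p : (ℝ × ℝ) × ℝ => ((p.1.2 : ℂ) + ((max p.1.1 2 + max p.2 0 : ℝ) : ℂ) * I)) := by
    fun_prop
  exact ContinuousAt.comp (g := riemannZeta) (differentiableAt_riemannZeta hne).continuousAt hc.continuousAt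

lemma zeta_continuousOn_line (σ T δ : ℝ) (hT : 2 ≤ T) :
    ContinuousOn (fun t : ℝ => ‖riemannZeta (σ + t * I)‖) (Set.Icc T (T+δ)) := by
  intro t ht
  apply ContinuousAt.continuousWithinAt
  apply ContinuousAt.norm
  have hne : ((σ : ℂ) + (t : ℂ) * I) ≠ 1 := by
    intro h
    have := congrArg Complex.im h
    simp at this
    linarith [ht.1]
  exact ContinuousAt.comp (g := riemannZeta) (differentiableAt_riemannZeta hne).continuousAt (by fun_prop)

lemma zeta_int_pos (σ T δ : ℝ) (hT : 2 ≤ T) (hδ : 0 < δ) :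
    0 < ∫ t in T..(T+δ), ‖riemannZeta (σ + t * I)‖ := by
  have hc := zeta_continuousOn_line σ T δ hT
  by_cases hex : ∃ t ∈ Set.Icc T (T+δ), riemannZeta (σ + t * I) ≠ 0
  · obtain ⟨t, ht, hne⟩ := hex
    exact intervalIntegral.integral_pos (by linarith) hc (fun _ _ => norm_nonneg _) ⟨t, ht, norm_pos_iff.2 hne⟩
  · exfalso
    push Not at hex
    have han : AnalyticOnNhd ℂ riemannZeta {1}ᶜ := differentiableOn_riemannZeta.analyticOnNhd isOpen_compl_singleton
    have hpc : IsPreconnected ({1}ᶜ : Set ℂ) :=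
      (isConnected_compl_singleton_of_one_lt_rank (by rw [Complex.rank_real_complex]; norm_num) 1).isPreconnected
    have hmem : ((σ:ℂ) + T * I) ∈ ({1}ᶜ : Set ℂ) := by
      intro h
      have := congrArg Complex.im h
      simp at this
      linarith
    have := han.eqOn_of_preconnected_of_frequently_eq (g := fun _ => 0) analyticOnNhd_const hpc hmem ?_
    · have h2 := this (show (2:ℂ) ∈ ({1}ᶜ : Set ℂ) by simp)
      exact riemannZeta_ne_zero_of_one_le_re (s := 2) (by simp) h2
    · have ht : Tendsto (fun t : ℝ => (σ:ℂ) + t * I) (nhdsWithin T (Set.Ioi T)) (nhdsWithin ((σ:ℂ) + T * I) {((σ:ℂ) + T * I)}ᶜ) := by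
        apply tendsto_nhdsWithin_of_tendsto_nhds_of_eventually_within
        · exact (Continuous.tendsto (by fun_prop) T).mono_left nhdsWithin_le_nhds
        · filter_upwards [self_mem_nhdsWithin] with t ht h
          have := congrArg Complex.im h
          simp at this
          exact (ne_of_gt ht) this
      apply ht.frequently
      apply Eventually.frequently
      filter_upwards [Ioo_mem_nhdsGT (show T < T + δ by linarith)] with t ht
      exact hex t ⟨ht.1.le, ht.2.le⟩

lemma compact_part (δ a T0 : ℝ) (hδ : 0 < δ) (ha : a ≤ 2) (hT0 : 2 ≤ T0) :
    ∃ C > (0:ℝ), ∀ T ∈ Set.Icc 2 T0, ∀ σ ∈ Set.Icc a 2,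
      C ≤ ∫ t in T..(T + δ), ‖riemannZeta (σ + t * I)‖ := by
  set F : ℝ × ℝ → ℝ := fun p => ∫ u in (0:ℝ)..δ, ‖riemannZeta ((p.2 : ℂ) + ((max p.1 2 + max u 0 : ℝ) : ℂ) * I)‖ with hF
  have hFc : Continuous F := by
    apply intervalIntegral.continuous_parametric_intervalIntegral_of_continuous'
    exact zeta_cont_shift
  have hFeq : ∀ T σ : ℝ, 2 ≤ T → F (T, σ) = ∫ t in T..(T + δ), ‖riemannZeta (σ + t * I)‖ := by
    intro T σ hT
    have h1 := intervalIntegral.integral_comp_add_left (a := 0) (b := δ) (fun t : ℝ => ‖riemannZeta (σ + t * I)‖) T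
    rw [add_zero] at h1
    rw [← h1]
    apply intervalIntegral.integral_congr
    intro u hu
    rw [Set.uIcc_of_le hδ.le] at hu
    simp only [max_eq_left hT, max_eq_left hu.1]
  obtain ⟨p, hp, hmin⟩ := (isCompact_Icc.prod isCompact_Icc : IsCompact (Set.Icc (2:ℝ) T0 ×ˢ Set.Icc a 2)).exists_isMinOn
    ⟨(2, 2), ⟨⟨le_rfl, hT0⟩, ⟨ha, le_rfl⟩⟩⟩ hFc.continuousOn
  refine ⟨F p, ?_, ?_⟩
  · rw [show p = (p.1, p.2) from rfl, hFeq _ _ hp.1.1]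
    exact zeta_int_pos _ _ _ hp.1.1 hδ
  · intro T hT σ hσ
    rw [← hFeq T σ hT.1]
    exact hmin (Set.mk_mem_prod hT hσ)

lemma zeta_large (s : ℂ) (hs : 2 ≤ s.re) : 1/4 ≤ ‖riemannZeta s‖ := by
  have h1 : 1 < s.re := by linarith
  have hz := hasSum_zeta_two
  have hsum : Summable (fun n : ℕ => 1 / ((n:ℂ)+1)^s) := by
    have := (summable_nat_add_iff 1).2 (Complex.summable_one_div_nat_cpow.2 h1)
    simpa using this
  have e := zeta_eq_tsum_one_div_nat_add_one_cpow h1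
  rw [hsum.tsum_eq_zero_add] at e
  have hb : ∀ n : ℕ, ‖1 / (((n+1:ℕ):ℂ)+1)^s‖ ≤ 1 / ((n+2:ℕ):ℝ)^2 := by
    intro n
    rw [norm_div, norm_one, show (((n+1:ℕ):ℂ)+1) = (((n+2:ℕ):ℝ):ℂ) by push_cast; ring, Complex.norm_cpow_eq_rpow_re_of_pos (by positivity)]
    gcongr
    rw [← Real.rpow_natCast]
    apply Real.rpow_le_rpow_of_exponent_le
    · push_cast; have : (0:ℝ) ≤ n := by positivity
      linarith
    · exact_mod_cast hs
  have h2 : HasSum (fun n : ℕ => 1 / ((n+2:ℕ):ℝ)^2) (Real.pi^2/6 - 1) := by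
    have := (hasSum_nat_add_iff' 2).2 hz
    simpa [Finset.sum_range_succ] using this
  have h3 := tsum_of_norm_bounded h2 hb
  have hpi : Real.pi^2/6 - 1 ≤ 3/4 := by nlinarith [Real.pi_lt_d2, Real.pi_pos]
  have h4 : riemannZeta s - ∑' n : ℕ, 1 / (((n+1:ℕ):ℂ)+1)^s = 1 := by
    rw [e]; simp
  have h5 := norm_sub_le (riemannZeta s) (∑' n : ℕ, 1 / (((n+1:ℕ):ℂ)+1)^s)
  rw [h4, norm_one] at h5
  linarith

lemma approx_bound (δ : ℝ) (hδ : 0 < δ) (e : ℝ) (he : 0 < e) : ∃ T2 : ℝ, 2 ≤ T2 ∧ ∀ T, T2 ≤ T → ∀ σ ∈ Set.Icc (3/4:ℝ) 2,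
    ∀ t ∈ Set.Icc T (T+δ), ‖riemannZeta (σ + t * I) - ∑ n ∈ Finset.range ⌊T^2⌋₊, ((n:ℂ)+1) ^ (-((σ:ℂ) + t * I))‖ ≤ e := by
  set S : ℝ := ∑' n : ℕ, ((n:ℝ)+1)^(-(3/20:ℝ)-1) with hS
  have hS0 : 0 ≤ S := tsum_nonneg fun n => by positivity
  have hlim : Tendsto (fun T : ℝ => T^(-(1/4:ℝ)) + (2+δ) * S * T^(-(1/5:ℝ))) atTop (nhds (0 + (2+δ)*S*0)) :=
    (tendsto_rpow_neg_atTop (by norm_num)).add ((tendsto_rpow_neg_atTop (by norm_num)).const_mul _)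
  rw [mul_zero, add_zero] at hlim
  obtain ⟨T1, hT1⟩ := eventually_atTop.1 (hlim.eventually (gt_mem_nhds he))
  refine ⟨max T1 2, le_max_right _ _, ?_⟩
  intro T hT σ hσ t ht
  have hT2 : 2 ≤ T := (le_max_right _ _).trans hT
  have hT0 : 0 < T := by linarith
  have hlt := hT1 T ((le_max_left _ _).trans hT)
  have hre : ((σ:ℂ) + t * I).re = σ := by simp
  have him : ((σ:ℂ) + t * I).im = t := by simp
  have hap := zeta_approx (σ + t * I) (by rw [hre]; exact hσ.1) (by rw [him]; linarith [ht.1]) ⌊T^2⌋₊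
  rw [hre, him] at hap
  set N := ⌊T^2⌋₊ with hN
  have hN1 : T^2 ≤ (N:ℝ)+1 := (Nat.lt_floor_add_one _).le
  have hN2 : (N:ℝ) ≤ T^2 := Nat.floor_le (by positivity)
  have hN3 : (N:ℝ)+1 ≤ T^3 := by nlinarith
  have hN4 : (1:ℝ) ≤ (N:ℝ)+1 := by have : (0:ℝ) ≤ N := by positivity
                                   linarith
  have b1 : ((N:ℝ)+1)^(1-σ) / t ≤ T^(-(1/4:ℝ)) := by
    calc _ ≤ T^(3/4:ℝ) / T := by
          gcongr
          · calc ((N:ℝ)+1)^(1-σ) ≤ ((N:ℝ)+1)^(1/4:ℝ) := Real.rpow_le_rpow_of_exponent_le hN4 (by linarith [hσ.1])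
              _ ≤ (T^3)^(1/4:ℝ) := by gcongr
              _ = _ := by rw [← Real.rpow_natCast, ← Real.rpow_mul hT0.le]; norm_num
          · exact ht.1
      _ = _ := by
          rw [← Real.rpow_sub_one hT0.ne']; norm_num
  have b2 : ‖(σ:ℂ) + t * I‖ ≤ (2+δ) * T := by
    refine (norm_add_le _ _).trans ?_
    rw [norm_mul, Complex.norm_I, Complex.norm_real, Complex.norm_real, Real.norm_of_nonneg (by linarith [hσ.1]), Real.norm_of_nonneg (by linarith [ht.1])]
    nlinarith [ht.2, hσ.2]
  have b3 : ((N:ℝ)+1)^(-(3/5:ℝ)) ≤ T^(-(6/5:ℝ)) := by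
    calc _ ≤ (T^2)^(-(3/5:ℝ)) := Real.rpow_le_rpow_of_nonpos (by positivity) hN1 (by norm_num)
      _ = _ := by rw [← Real.rpow_natCast, ← Real.rpow_mul hT0.le]; norm_num
  have b4 : T * T^(-(6/5:ℝ)) = T^(-(1/5:ℝ)) := by
    rw [mul_comm, ← Real.rpow_add_one hT0.ne']; norm_num
  calc _ ≤ _ := hap
    _ ≤ T^(-(1/4:ℝ)) + ((2+δ) * T) * (T^(-(6/5:ℝ)) * S) := by gcongr
    _ = T^(-(1/4:ℝ)) + (2+δ) * S * (T * T^(-(6/5:ℝ))) := by ring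
    _ ≤ e := by rw [b4]; exact hlt.le

/-- Theorem 7: if ω(t) ≤ 1 is increasing with ∫₂^∞ (1-ω(t))/(t log t) dt < ∞,
then for each δ > 0 there is C_δ > 0 with ∫_T^{T+δ} |ζ(σ+it)| dt ≥ C_δ for all
T ≥ 2 and all σ ≥ ω(T). -/
theorem zeta_short_interval_lower_bound
    (ω : ℝ → ℝ) (hmono : Monotone ω) (hle : ∀ t, ω t ≤ 1)
    (hint : IntegrableOn (fun t : ℝ => (1 - ω t) / (t * Real.log t)) (Set.Ici 2)) :
    ∀ δ > (0:ℝ), ∃ C > (0:ℝ), ∀ T : ℝ, 2 ≤ T → ∀ σ : ℝ, ω T ≤ σ →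
      C ≤ ∫ t in T..(T + δ), ‖riemannZeta (σ + t * Complex.I)‖ := by
  intro δ hδ
  have hq := summable_q ω hmono hle hint
  obtain ⟨C1, hC1, hD⟩ := dirichlet_lower ω hmono hle hq δ hδ
  obtain ⟨k, hk⟩ := (hq.tendsto_atTop_zero.eventually (gt_mem_nhds (show (0:ℝ) < 1/4 by norm_num))).exists
  obtain ⟨T2, hT2, hA⟩ := approx_bound δ hδ (C1/(2*δ)) (by positivity)
  set T3 := max (Real.exp (2^k)) T2 with hT3
  obtain ⟨C2, hC2, hE⟩ := compact_part δ (ω 2) T3 hδ ((hle 2).trans (by norm_num)) (hT2.trans (le_max_right _ _))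
  refine ⟨min (min (C1/2) C2) (δ * (1/4)), by positivity, ?_⟩
  intro T hT σ hσ
  have hzi : IntervalIntegrable (fun t : ℝ => ‖riemannZeta (σ + t * I)‖) volume T (T+δ) := by
    apply ContinuousOn.intervalIntegrable
    rw [Set.uIcc_of_le (by linarith)]
    exact zeta_continuousOn_line σ T δ hT
  by_cases hσ2 : 2 < σ
  · refine (min_le_right _ _).trans ?_
    calc δ * (1/4) = ∫ t in T..(T+δ), (1/4:ℝ) := by simp
      _ ≤ _ := by
        apply intervalIntegral.integral_mono_on (by linarith) intervalIntegrable_const hzi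
        intro t _
        apply zeta_large
        simpa using hσ2.le
  push Not at hσ2
  refine (min_le_left _ _).trans ?_
  by_cases hTs : T ≤ T3
  · exact (min_le_right _ _).trans (hE T ⟨hT, hTs⟩ σ ⟨(hmono hT).trans hσ, hσ2⟩)
  push Not at hTs
  refine (min_le_left _ _).trans ?_
  have hσ1 : 3/4 ≤ σ := by
    have := hmono ((le_max_left _ _).trans hTs.le : Real.exp (2^k) ≤ T)
    linarith
  have hap := hA T ((le_max_right _ _).trans hTs.le) σ ⟨hσ1, hσ2⟩
  set N := ⌊T^2⌋₊ with hN
  have hN1 : 1 ≤ N := by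
    rw [hN, Nat.one_le_floor_iff]; nlinarith
  have hDD := hD T σ (N+1) (by linarith) hσ (by omega) ?_
  · have heq : ∀ t : ℝ, ∑ n ∈ Finset.Ico 1 (N+1), ((Real.exp (-(Real.log n * σ)) : ℝ) : ℂ) * cexp (-(Real.log n * t) * I)
        = ∑ n ∈ Finset.range N, ((n:ℂ)+1) ^ (-((σ:ℂ) + t * I)) := by
      intro t
      rw [Finset.sum_Ico_eq_sum_range]
      simp only [Nat.add_sub_cancel]
      apply Finset.sum_congr rfl
      intro n _
      have h0 : (0:ℝ) < ((1+n : ℕ):ℝ) := by positivity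
      rw [show ((n:ℂ)+1) = (((1+n:ℕ):ℝ):ℂ) by push_cast; ring, Complex.cpow_def_of_ne_zero (by exact_mod_cast h0.ne'), ← Complex.ofReal_log h0.le, Complex.ofReal_exp, ← Complex.exp_add]
      congr 1
      push_cast; ring
    have hi2 : IntervalIntegrable (fun t : ℝ => ‖∑ n ∈ Finset.Ico 1 (N+1), ((Real.exp (-(Real.log n * σ)) : ℝ) : ℂ) * cexp (-(Real.log n * t) * I)‖) volume T (T+δ) := by
      apply Continuous.intervalIntegrable; fun_prop
    have hm : ∫ t in T..(T+δ), ‖∑ n ∈ Finset.Ico 1 (N+1), ((Real.exp (-(Real.log n * σ)) : ℝ) : ℂ) * cexp (-(Real.log n * t) * I)‖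
        ≤ ∫ t in T..(T+δ), (‖riemannZeta (σ + t * I)‖ + C1/(2*δ)) := by
      apply intervalIntegral.integral_mono_on (by linarith) hi2 (hzi.add intervalIntegrable_const)
      intro t ht
      rw [heq t]
      have h1 := hap t ht
      have h2 := norm_le_norm_add_norm_sub (riemannZeta (σ + t * I)) (∑ n ∈ Finset.range N, ((n:ℂ)+1) ^ (-((σ:ℂ) + t * I)))
      linarith
    rw [intervalIntegral.integral_add hzi intervalIntegrable_const] at hm
    have : ∫ t in T..(T+δ), C1/(2*δ) = C1/2 := by
      simp; field_simp
    linarith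
  · intro n hn
    have h1 : n ≤ N := by have := (Finset.mem_Ico.1 hn).2; omega
    exact (Nat.cast_le.2 h1).trans (Nat.floor_le (by positivity))
end
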